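/- arXiv:2007.07303 — 9 statements merged into one kernel-verified Lean document; each statement's English description precedes it below -/
import Mathlib

section
/- Let n ≥ 1 and 1 ≤ d ≤ n be integers, and let F be a coprime integer multilinear (n,d)-form. Suppose that at least one of the following holds: (a) the nonzero coefficients of F are pairwise coprime, or (b) n = d+1 and F has a pair of coprime coefficients. Then for every integer b there exists a vector a ∈ ℤⁿ such that F(a) = b and |a| ≤ |b|·(2|F|)^{d!·e}, where e = 2.71828… is Euler's number. In particular, F represents all integers. -/
open Finset

/-- The value at `a` of the multilinear form of degree `d` in the variables indexed by `S`. -/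
def multilinearEval {ι : Type*} (S : Finset ι) (d : ℕ) (f : Finset ι → ℤ) (a : ι → ℤ) : ℤ :=
  ∑ I ∈ powersetCard d S, f I * ∏ i ∈ I, a i

/-- Every nonzero `b` is a value of the form at a point of size at most `|b| (2K)^(2 d! - 1)`. -/
def BoundedlyUniversal {ι : Type*} (K : ℤ) (S : Finset ι) (d : ℕ) (f : Finset ι → ℤ) : Prop :=
  ∀ b : ℤ, b ≠ 0 → ∃ a : ι → ℤ, multilinearEval S d f a = b ∧
    ∀ i, |a i| ≤ |b| * (2 * K) ^ (2 * d.factorial - 1)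

section MultilinearForms

variable {ι : Type*} [DecidableEq ι]

theorem exists_bounded_bezout {p q K : ℤ} (h : IsCoprime p q) (hK : 1 ≤ K) (hq : |q| ≤ K)
    (hp : |p| ≤ K) : ∃ u v : ℤ, u * p + v * q = 1 ∧ |u| ≤ K ∧ |v| ≤ K := by
  obtain ⟨u, v, huv⟩ := h
  rcases eq_or_ne q 0 with rfl | hq0
  · refine ⟨u, 0, by simpa using huv, ?_, by simpa using by omega⟩
    have : IsUnit u := IsUnit.of_mul_eq_one p (by simpa using huv)
    rw [Int.isUnit_iff_abs_eq.mp this]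
    exact hK
  · have hq1 : 0 < |q| := abs_pos.mpr hq0
    have hu0 : 0 ≤ u % q := Int.emod_nonneg _ hq0
    have hu1 : u % q < |q| := Int.emod_lt_abs _ hq0
    have hu : |u % q| = u % q := abs_of_nonneg hu0
    have hdiv : u % q + q * (u / q) = u := Int.emod_add_mul_ediv u q
    have hbez : (u % q) * p + (v + u / q * p) * q = 1 := by
      linear_combination huv + p * hdiv
    refine ⟨u % q, v + u / q * p, hbez, by omega, ?_⟩
    have hmul : |v + u / q * p| * |q| ≤ 1 + (|q| - 1) * K := by
      rw [← abs_mul, show (v + u / q * p) * q = 1 - (u % q) * p by linarith]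
      calc |1 - u % q * p| ≤ |1| + |u % q * p| := abs_sub _ _
        _ = 1 + |u % q| * |p| := by rw [abs_mul, abs_one]
        _ ≤ 1 + (|q| - 1) * K := by
          gcongr
          · omega
          · omega
    nlinarith

theorem multilinearEval_insert {T : Finset ι} {i : ι} (hi : i ∉ T) (d : ℕ)
    (f : Finset ι → ℤ) (a : ι → ℤ) :
    multilinearEval (insert i T) (d + 1) f a =
      multilinearEval T (d + 1) f a +
        a i * multilinearEval T d (fun I => f (insert i I)) a := by
  have hmem : ∀ I ∈ powersetCard d T, i ∉ I := fun I hI h =>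
    hi ((mem_powersetCard.mp hI).1 h)
  unfold multilinearEval
  rw [powersetCard_succ_insert hi, sum_union, sum_image, mul_sum]
  · congr 1
    refine sum_congr rfl fun I hI => ?_
    rw [prod_insert (hmem I hI)]
    ring
  · intro I hI J hJ h
    rw [← erase_insert (hmem I hI), ← erase_insert (hmem J hJ), h]
  · rw [disjoint_left]
    intro I hI hI'
    obtain ⟨J, -, rfl⟩ := mem_image.mp hI'
    exact hi ((mem_powersetCard.mp hI).1 (mem_insert_self i J))

theorem multilinearEval_congr {ι : Type*} {S : Finset ι} {d : ℕ} {f : Finset ι → ℤ} {a a' : ι → ℤ}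
    (h : ∀ i ∈ S, a i = a' i) : multilinearEval S d f a = multilinearEval S d f a' := by
  refine sum_congr rfl fun I hI => ?_
  rw [prod_congr rfl fun i hi => h i ((mem_powersetCard.mp hI).1 hi)]

theorem multilinearEval_indicator {S T : Finset ι} (hTS : T ⊆ S) (d : ℕ) (f : Finset ι → ℤ)
    (a : ι → ℤ) :
    multilinearEval S d f (fun i => if i ∈ T then a i else 0) = multilinearEval T d f a := by
  rw [← multilinearEval_congr (S := T) (a := fun i => if i ∈ T then a i else 0)
    (by simp +contextual)]
  refine (sum_subset (powersetCard_mono hTS) fun I hI hIT => ?_).symm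
  have : ¬ I ⊆ T := fun h => hIT (mem_powersetCard.mpr ⟨h, (mem_powersetCard.mp hI).2⟩)
  obtain ⟨i, hiI, hiT⟩ := not_subset.mp this
  rw [prod_eq_zero hiI (by simp [hiT]), mul_zero]

theorem BoundedlyUniversal.mono {S T : Finset ι} (hTS : T ⊆ S) {K : ℤ} (hK : 1 ≤ K) {d : ℕ}
    {f : Finset ι → ℤ} (h : BoundedlyUniversal K T d f) : BoundedlyUniversal K S d f := by
  intro b hb
  obtain ⟨a, hab, ha⟩ := h b hb
  refine ⟨_, (multilinearEval_indicator hTS d f a).trans hab, fun i => ?_⟩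
  split_ifs
  · exact ha i
  · rw [abs_zero]
    positivity

/-- A form with at most one nonzero monomial is bounded by the size of that monomial. -/
theorem abs_multilinearEval_le {ι : Type*} {S : Finset ι} {d : ℕ} {f : Finset ι → ℤ}
    {a : ι → ℤ} {K A : ℤ}
    (hK : 0 ≤ K) (hA : 0 ≤ A) (hf : ∀ I ∈ powersetCard d S, |f I| ≤ K) (ha : ∀ i, |a i| ≤ A)
    (hone : ∀ I ∈ powersetCard d S, ∀ J ∈ powersetCard d S, f I ≠ 0 → f J ≠ 0 → I = J) :
    |multilinearEval S d f a| ≤ K * A ^ d := by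
  by_cases h : ∃ I ∈ powersetCard d S, f I ≠ 0
  · obtain ⟨I, hI, hfI⟩ := h
    rw [multilinearEval, sum_eq_single_of_mem I hI, abs_mul, abs_prod]
    · gcongr
      · exact hf I hI
      · rw [← (mem_powersetCard.mp hI).2]
        exact (prod_le_prod (fun i _ => abs_nonneg _) fun i _ => ha i).trans_eq (by simp)
    · intro J hJ hJI
      by_contra hne
      exact hJI (hone J hJ I hI (left_ne_zero_of_mul hne) hfI)
  · push Not at h
    rw [multilinearEval, sum_eq_zero fun I hI => by rw [h I hI, zero_mul], abs_zero]
    positivity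

/-- If the coefficient form of `x_i` is universal and at most one nonzero monomial avoids `x_i`,
the whole form is universal. -/
theorem BoundedlyUniversal.insert {T : Finset ι} {i : ι} (hi : i ∉ T) {K : ℤ} (hK : 1 ≤ K)
    {d : ℕ} (hd : 1 ≤ d) {f : Finset ι → ℤ}
    (hf : ∀ I ∈ powersetCard (d + 1) T, |f I| ≤ K)
    (hone : ∀ I ∈ powersetCard (d + 1) T, ∀ J ∈ powersetCard (d + 1) T,
      f I ≠ 0 → f J ≠ 0 → I = J)
    (h : BoundedlyUniversal K T d fun I => f (insert i I)) :
    BoundedlyUniversal K (insert i T) (d + 1) f := by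
  intro b hb
  obtain ⟨a, hab, ha⟩ := h 1 one_ne_zero
  simp only [abs_one, one_mul] at ha
  have hb1 : 1 ≤ |b| := Int.one_le_abs hb
  have hK2 : 1 ≤ 2 * K := by omega
  have hfac : 1 ≤ d.factorial := d.factorial_pos
  have hexp : (2 * d.factorial - 1) * (d + 1) + 1 ≤ 2 * (d + 1).factorial - 1 := by
    rw [Nat.factorial_succ]
    zify [show 1 ≤ 2 * d.factorial by omega,
      show 1 ≤ 2 * ((d + 1) * d.factorial) by nlinarith]
    nlinarith
  set A := (2 * K) ^ (2 * d.factorial - 1) with hA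
  have hA1 : 1 ≤ A := one_le_pow₀ hK2
  have hH := abs_multilinearEval_le (by omega) (by omega) hf ha hone
  have hAd : 1 ≤ A ^ (d + 1) := one_le_pow₀ hA1
  refine ⟨Function.update a i (b - multilinearEval T (d + 1) f a), ?_, fun j => ?_⟩
  · have hne : ∀ j ∈ T, Function.update a i (b - multilinearEval T (d + 1) f a) j = a j :=
      fun j hj => Function.update_of_ne (ne_of_mem_of_not_mem hj hi) _ _
    rw [multilinearEval_insert hi, multilinearEval_congr hne, multilinearEval_congr hne, hab,
      Function.update_self]
    ring
  · rcases eq_or_ne j i with rfl | hj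
    · rw [Function.update_self]
      calc |b - multilinearEval T (d + 1) f a|
          ≤ |b| + |multilinearEval T (d + 1) f a| := abs_sub _ _
        _ ≤ |b| + K * A ^ (d + 1) := by gcongr
        _ ≤ |b| * (A ^ (d + 1) * (2 * K)) := by
          have h1 : 1 ≤ K * A ^ (d + 1) := by nlinarith
          nlinarith
        _ = |b| * (2 * K) ^ ((2 * d.factorial - 1) * (d + 1) + 1) := by
          rw [hA, ← pow_mul, pow_succ]
        _ ≤ _ := by gcongr
    · rw [Function.update_of_ne hj]
      calc |a j| ≤ A := ha j
        _ ≤ (2 * K) ^ (2 * (d + 1).factorial - 1) := by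
          rw [hA]
          apply pow_le_pow_right₀ hK2
          nlinarith
        _ ≤ _ := le_mul_of_one_le_left (by positivity) hb1

/-- A form with exactly two monomials, with no common variable. -/
theorem boundedlyUniversal_of_disjoint {S : Finset ι} {K : ℤ} (hK : 1 ≤ K) {d : ℕ} (hd : 1 ≤ d)
    {f : Finset ι → ℤ} {I J : Finset ι} (hI : I ∈ powersetCard d S) (hJ : J ∈ powersetCard d S)
    (hdisj : Disjoint I J) (hcop : IsCoprime (f I) (f J)) (hfI : |f I| ≤ K) (hfJ : |f J| ≤ K)
    (hother : ∀ L ∈ powersetCard d S, f L ≠ 0 → L = I ∨ L = J) :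
    BoundedlyUniversal K S d f := by
  intro b hb
  have hb1 : 1 ≤ |b| := Int.one_le_abs hb
  obtain ⟨u, v, huv, hu, hv⟩ := exists_bounded_bezout hcop hK hfJ hfI
  obtain ⟨x, hx⟩ : I.Nonempty := card_pos.mp (by rw [(mem_powersetCard.mp hI).2]; omega)
  obtain ⟨y, hy⟩ : J.Nonempty := card_pos.mp (by rw [(mem_powersetCard.mp hJ).2]; omega)
  have hxJ : x ∉ J := disjoint_left.mp hdisj hx
  have hyI : y ∉ I := disjoint_right.mp hdisj hy
  have hIJ : I ≠ J := fun h => hxJ (h ▸ hx)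
  let a : ι → ℤ := fun i => if i = x then u * b else if i = y then v * b else 1
  have hprodI : ∏ i ∈ I, a i = u * b := by
    rw [prod_eq_single_of_mem x hx]
    · simp [a]
    · intro j hj hjx
      have : j ≠ y := fun h => hyI (h ▸ hj)
      simp [a, hjx, this]
  have hprodJ : ∏ i ∈ J, a i = v * b := by
    rw [prod_eq_single_of_mem y hy]
    · have : y ≠ x := fun h => hxJ (h ▸ hy)
      simp [a, this]
    · intro j hj hjy
      have : j ≠ x := fun h => hxJ (h ▸ hj)
      simp [a, hjy, this]
  refine ⟨a, ?_, fun i => ?_⟩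
  · rw [multilinearEval, sum_eq_add_of_mem I J hI hJ hIJ, hprodI, hprodJ]
    · linear_combination b * huv
    · intro L hL hne
      by_contra h
      rcases hother L hL (left_ne_zero_of_mul h) with h' | h'
      exacts [hne.1 h', hne.2 h']
  · have hfac : 1 ≤ d.factorial := d.factorial_pos
    have hpow : K ≤ (2 * K) ^ (2 * d.factorial - 1) :=
      calc K ≤ (2 * K) ^ 1 := by rw [pow_one]; omega
        _ ≤ _ := pow_le_pow_right₀ (by omega) (by omega)
    have hai : |a i| ≤ |b| * K := by
      simp only [a]
      split_ifs
      · rw [abs_mul, mul_comm]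
        gcongr
      · rw [abs_mul, mul_comm]
        gcongr
      · rw [abs_one]
        nlinarith
    exact hai.trans (by gcongr)

theorem insert_mem_powersetCard_insert {T I : Finset ι} {i : ι} {d : ℕ}
    (hI : I ∈ powersetCard d T) (hi : i ∉ T) : insert i I ∈ powersetCard (d + 1) (insert i T) := by
  rw [mem_powersetCard] at hI ⊢
  exact ⟨insert_subset_insert i hI.1, by
    rw [card_insert_of_notMem fun h => hi (hI.1 h), hI.2]⟩

theorem erase_mem_powersetCard_erase {S I : Finset ι} {i : ι} {d : ℕ}
    (hI : I ∈ powersetCard (d + 1) S) (hi : i ∈ I) : I.erase i ∈ powersetCard d (S.erase i) := by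
  rw [mem_powersetCard] at hI ⊢
  exact ⟨erase_subset_erase i hI.1, by rw [card_erase_of_mem hi, hI.2, Nat.add_sub_cancel]⟩

theorem boundedlyUniversal_of_card_eq_succ {K : ℤ} (hK : 1 ≤ K) {d : ℕ} (hd : 1 ≤ d) :
    ∀ {S : Finset ι} {f : Finset ι → ℤ} {I J : Finset ι}, S.card = d + 1 →
      (∀ I ∈ powersetCard d S, |f I| ≤ K) → I ∈ powersetCard d S → J ∈ powersetCard d S →
      I ≠ J → IsCoprime (f I) (f J) → BoundedlyUniversal K S d f := by
  induction d, hd using Nat.le_induction with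
  | base =>
    intro S f I J hS hf hI hJ hne hcop
    refine boundedlyUniversal_of_disjoint hK le_rfl hI hJ ?_ hcop (hf I hI) (hf J hJ) ?_
    · obtain ⟨x, rfl⟩ := card_eq_one.mp (mem_powersetCard.mp hI).2
      obtain ⟨y, rfl⟩ := card_eq_one.mp (mem_powersetCard.mp hJ).2
      simpa using hne
    · intro L hL _
      have hcard : (powersetCard 1 S).card = 2 := by simp [hS]
      have hpair : ({I, J} : Finset (Finset ι)) = powersetCard 1 S :=
        eq_of_subset_of_card_le (insert_subset hI (singleton_subset_iff.mpr hJ))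
          (by rw [hcard, card_pair hne])
      simpa [← hpair] using hL
  | succ d hd ih =>
    intro S f I J hS hf hI hJ hne hcop
    obtain ⟨hIS, hIc⟩ := mem_powersetCard.mp hI
    obtain ⟨hJS, hJc⟩ := mem_powersetCard.mp hJ
    obtain ⟨i, hi⟩ : (I ∩ J).Nonempty := by
      rw [← card_pos]
      have h1 := card_union_add_card_inter I J
      have h2 := card_le_card (union_subset hIS hJS)
      omega
    obtain ⟨hiI, hiJ⟩ := mem_inter.mp hi
    have hiS : i ∈ S := hIS hiI
    have hcard : (S.erase i).card = d + 1 := by rw [card_erase_of_mem hiS, hS]; rfl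
    rw [← insert_erase hiS]
    refine BoundedlyUniversal.insert (notMem_erase i S) hK hd
      (fun L hL => hf L (powersetCard_mono (erase_subset i S) hL)) ?_ ?_
    · intro L hL M hM _ _
      rw [← hcard, powersetCard_self, mem_singleton] at hL hM
      rw [hL, hM]
    · refine ih (I := I.erase i) (J := J.erase i) hcard (fun L hL => ?_)
        (erase_mem_powersetCard_erase hI hiI) (erase_mem_powersetCard_erase hJ hiJ) ?_ ?_
      · have := insert_mem_powersetCard_insert hL (notMem_erase i S)
        rw [insert_erase hiS] at this
        exact hf _ this
      · intro h
        apply hne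
        rw [← insert_erase hiI, h, insert_erase hiJ]
      · simpa [insert_erase hiI, insert_erase hiJ] using hcop

/-- Two distinct monomials with nonzero coefficients are supported on `S`. -/
def HasTwoMonomials {ι : Type*} (S : Finset ι) (d : ℕ) (f : Finset ι → ℤ) : Prop :=
  ∃ I ∈ powersetCard d S, ∃ J ∈ powersetCard d S, I ≠ J ∧ f I ≠ 0 ∧ f J ≠ 0

theorem boundedlyUniversal_of_pairwise_coprime {K : ℤ} (hK : 1 ≤ K) {d : ℕ} (hd : 1 ≤ d) :
    ∀ {S : Finset ι} {f : Finset ι → ℤ}, (∀ I ∈ powersetCard d S, |f I| ≤ K) →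
      (∀ I ∈ powersetCard d S, ∀ J ∈ powersetCard d S, I ≠ J → f I ≠ 0 → f J ≠ 0 →
        IsCoprime (f I) (f J)) →
      HasTwoMonomials S d f → BoundedlyUniversal K S d f := by
  induction d using Nat.strong_induction_on with | _ d ih
  intro S
  induction S using Finset.strongInduction with | H S ihS
  intro f hf hcop htwo
  by_cases hmin : ∃ T, T ⊂ S ∧ HasTwoMonomials T d f
  · obtain ⟨T, hTS, hT⟩ := hmin
    have hsub := powersetCard_mono (n := d) hTS.subset
    exact (ihS T hTS (fun I hI => hf I (hsub hI))
      (fun I hI J hJ => hcop I (hsub hI) J (hsub hJ)) hT).mono hTS.subset hK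
  have herase : ∀ i ∈ S, ∀ I ∈ powersetCard d (S.erase i), ∀ J ∈ powersetCard d (S.erase i),
      f I ≠ 0 → f J ≠ 0 → I = J := by
    intro i hi I hI J hJ hfI hfJ
    by_contra hne
    exact hmin ⟨S.erase i, erase_ssubset hi, I, hI, J, hJ, hne, hfI, hfJ⟩
  by_cases hshare : ∃ i, ∃ I ∈ powersetCard d S, ∃ J ∈ powersetCard d S,
      I ≠ J ∧ f I ≠ 0 ∧ f J ≠ 0 ∧ i ∈ I ∧ i ∈ J
  · obtain ⟨i, I, hI, J, hJ, hne, hfI, hfJ, hiI, hiJ⟩ := hshare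
    have hiS : i ∈ S := (mem_powersetCard.mp hI).1 hiI
    obtain ⟨e, rfl⟩ : ∃ e, d = e + 1 := ⟨d - 1, by omega⟩
    have hne' : I.erase i ≠ J.erase i := by
      intro h
      apply hne
      rw [← insert_erase hiI, h, insert_erase hiJ]
    have hIe := erase_mem_powersetCard_erase hI hiI
    have hJe := erase_mem_powersetCard_erase hJ hiJ
    have he : 1 ≤ e := by
      by_contra h0
      obtain rfl : e = 0 := by omega
      rw [powersetCard_zero, mem_singleton] at hIe hJe
      exact hne' (hIe.trans hJe.symm)
    have hins : ∀ L ∈ powersetCard e (S.erase i), insert i L ∈ powersetCard (e + 1) S := by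
      intro L hL
      have := insert_mem_powersetCard_insert hL (notMem_erase i S)
      rwa [insert_erase hiS] at this
    have hinj : ∀ L ∈ powersetCard e (S.erase i), (insert i L).erase i = L := fun L hL =>
      erase_insert fun h => notMem_erase i S ((mem_powersetCard.mp hL).1 h)
    rw [← insert_erase hiS]
    refine BoundedlyUniversal.insert (notMem_erase i S) hK he
      (fun L hL => hf L (powersetCard_mono (erase_subset i S) hL)) (herase i hiS) ?_
    refine ih e (by omega) he (fun L hL => hf _ (hins L hL))
      (fun L hL M hM hLM => hcop _ (hins L hL) _ (hins M hM) fun h => hLM ?_)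
      ⟨_, hIe, _, hJe, hne', by simpa only [insert_erase hiI],
        by simpa only [insert_erase hiJ]⟩
    rw [← hinj L hL, h, hinj M hM]
  · push Not at hshare
    obtain ⟨I, hI, J, hJ, hne, hfI, hfJ⟩ := htwo
    refine boundedlyUniversal_of_disjoint hK hd hI hJ ?_ (hcop I hI J hJ hne hfI hfJ) (hf I hI)
      (hf J hJ) fun L hL hfL => ?_
    · exact disjoint_left.mpr fun i hiI => hshare i I hI J hJ hne hfI hfJ hiI
    · by_contra! hL'
      obtain ⟨hIS, hIc⟩ := mem_powersetCard.mp hI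
      obtain ⟨x, hx⟩ : I.Nonempty := card_pos.mp (by omega)
      have hmem : ∀ M ∈ powersetCard d S, f M ≠ 0 → I ≠ M → M ∈ powersetCard d (S.erase x) := by
        intro M hM hfM hIM
        obtain ⟨hMS, hMc⟩ := mem_powersetCard.mp hM
        exact mem_powersetCard.mpr
          ⟨subset_erase.mpr ⟨hMS, hshare x I hI M hM hIM hfI hfM hx⟩, hMc⟩
      exact hL'.2 (herase x (hIS hx) L (hmem L hL hfL hL'.1.symm) J (hmem J hJ hfJ hne) hfL hfJ)

/-- A form with a single monomial, whose coefficient is a unit. -/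
theorem boundedlyUniversal_of_isUnit {S : Finset ι} {K : ℤ} (hK : 1 ≤ K) {d : ℕ} (hd : 1 ≤ d)
    {f : Finset ι → ℤ} {I : Finset ι} (hI : I ∈ powersetCard d S) (hunit : IsUnit (f I))
    (hother : ∀ L ∈ powersetCard d S, L ≠ I → f L = 0) : BoundedlyUniversal K S d f := by
  intro b hb
  obtain ⟨x, hx⟩ : I.Nonempty := card_pos.mp (by rw [(mem_powersetCard.mp hI).2]; omega)
  refine ⟨fun i => if i = x then f I * b else 1, ?_, fun i => ?_⟩
  · rw [multilinearEval, sum_eq_single_of_mem I hI, prod_ite_eq_of_mem' I x _ hx, ← mul_assoc,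
      Int.isUnit_mul_self hunit, one_mul]
    intro L hL hLI
    rw [hother L hL hLI, zero_mul]
  · have hai : |if i = x then f I * b else 1| ≤ |b| := by
      split_ifs
      · rw [abs_mul, Int.isUnit_iff_abs_eq.mp hunit, one_mul]
      · rw [abs_one]
        exact Int.one_le_abs hb
    exact hai.trans (le_mul_of_one_le_right (abs_nonneg b) (one_le_pow₀ (by omega)))

end MultilinearForms

/-- Let `1 ≤ d ≤ n` and let `F(x) = ∑_{|I| = d} f_I ∏_{i ∈ I} x_i` be a
coprime integer multilinear `(n,d)`-form.  If (a) the nonzero coefficients of `F` are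
pairwise coprime, or (b) `n = d + 1` and `F` has a pair of coprime coefficients, then for
every integer `b` there is `a ∈ ℤⁿ` with `F(a) = b` and `|a| ≤ |b| · (2|F|)^{d!·e}`. -/
theorem stmt_0 (n d : ℕ) (hn : 1 ≤ n) (hd : 1 ≤ d) (hdn : d ≤ n)
    (f : Finset (Fin n) → ℤ)
    (hcoprime :
      Finset.gcd (Finset.powersetCard d (Finset.univ : Finset (Fin n))) f = 1)
    (hab :
      (∀ I ∈ Finset.powersetCard d (Finset.univ : Finset (Fin n)),
        ∀ J ∈ Finset.powersetCard d (Finset.univ : Finset (Fin n)),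
          I ≠ J → f I ≠ 0 → f J ≠ 0 → IsCoprime (f I) (f J)) ∨
      (n = d + 1 ∧
        ∃ I ∈ Finset.powersetCard d (Finset.univ : Finset (Fin n)),
          ∃ J ∈ Finset.powersetCard d (Finset.univ : Finset (Fin n)),
            I ≠ J ∧ IsCoprime (f I) (f J))) :
    ∀ b : ℤ, ∃ a : Fin n → ℤ,
      (∑ I ∈ Finset.powersetCard d (Finset.univ : Finset (Fin n)),
        f I * ∏ i ∈ I, a i) = b ∧
      ∀ i : Fin n,
        ((a i).natAbs : ℝ) ≤
          (b.natAbs : ℝ) *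
            ((2 * ((Finset.powersetCard d (Finset.univ : Finset (Fin n))).sup
                fun I => (f I).natAbs) : ℕ) : ℝ) ^ ((d.factorial : ℝ) * Real.exp 1) := by
  intro b
  rcases eq_or_ne b 0 with rfl | hb
  · refine ⟨0, sum_eq_zero fun I hI => ?_, by simp⟩
    have hcard : I.card ≠ 0 := by rw [(mem_powersetCard.mp hI).2]; omega
    simp [prod_const, hcard]
  set P := powersetCard d (univ : Finset (Fin n))
  set K : ℕ := P.sup fun I => (f I).natAbs
  have hle : ∀ I ∈ P, |f I| ≤ (K : ℤ) := fun I hI => by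
    rw [Int.abs_eq_natAbs]
    exact_mod_cast le_sup (f := fun I => (f I).natAbs) hI
  obtain ⟨I₀, hI₀, hfI₀⟩ : ∃ I ∈ P, f I ≠ 0 := by
    by_contra! h
    rw [Finset.gcd_eq_zero_iff.mpr h] at hcoprime
    exact zero_ne_one hcoprime
  have hK : (1 : ℤ) ≤ K := (Int.one_le_abs hfI₀).trans (hle I₀ hI₀)
  have huniv : BoundedlyUniversal (K : ℤ) univ d f := by
    rcases hab with ha | ⟨rfl, I, hI, J, hJ, hne, hcop⟩
    · by_cases htwo : HasTwoMonomials univ d f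
      · exact boundedlyUniversal_of_pairwise_coprime hK hd hle ha htwo
      · have hother : ∀ L ∈ P, L ≠ I₀ → f L = 0 := by
          intro L hL hne
          by_contra hfL
          exact htwo ⟨L, hL, I₀, hI₀, hne, hfL, hfI₀⟩
        refine boundedlyUniversal_of_isUnit hK hd hI₀ (isUnit_of_dvd_one ?_) hother
        rw [← hcoprime]
        refine Finset.dvd_gcd fun L hL => ?_
        rcases eq_or_ne L I₀ with rfl | hne
        · exact dvd_rfl
        · exact hother L hL hne ▸ dvd_zero _
    · exact boundedlyUniversal_of_card_eq_succ hK hd (by simp) hle hI hJ hne hcop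
  obtain ⟨a, hab, ha⟩ := huniv b hb
  refine ⟨a, hab, fun i => ?_⟩
  have hai : ((a i).natAbs : ℝ) ≤ b.natAbs * ((2 * K : ℕ) : ℝ) ^ (2 * d.factorial - 1) := by
    have := ha i
    rw [Int.abs_eq_natAbs, Int.abs_eq_natAbs] at this
    exact_mod_cast this
  have hbase : (1 : ℝ) ≤ ((2 * K : ℕ) : ℝ) := by
    have : 1 ≤ 2 * K := by omega
    exact_mod_cast this
  refine hai.trans (mul_le_mul_of_nonneg_left ?_ (Nat.cast_nonneg _))
  rw [← Real.rpow_natCast]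
  refine Real.rpow_le_rpow_of_exponent_le hbase ?_
  calc ((2 * d.factorial - 1 : ℕ) : ℝ) ≤ ((2 * d.factorial : ℕ) : ℝ) := by
        exact_mod_cast Nat.sub_le _ _
    _ = d.factorial * 2 := by push_cast; ring
    _ ≤ d.factorial * Real.exp 1 := by
        gcongr
        linarith [Real.add_one_le_exp 1]
end

section
/- Let n ≥ 1 and 1 ≤ d ≤ n be integers, and let F be a coprime integer multilinear (n,d)-form whose nonzero coefficients are pairwise coprime. Then for every integer b there exists a vector a ∈ ℤⁿ such that F(a) = b and |a| ≤ |b|·(2|F|)^{ν_d}, where ν_d = ∑_{k=0}^{d} d!/k!. -/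
namespace MultilinearForm

open Finset

/-- The value at `a` of the multilinear form of degree `d` in the variables indexed by `S`
with coefficients `f`. -/
def eval {α : Type*} (f : Finset α → ℤ) (d : ℕ) (S : Finset α) (a : α → ℤ) : ℤ :=
  ∑ I ∈ powersetCard d S, f I * ∏ i ∈ I, a i

theorem eval_congr {α : Type*} (f : Finset α → ℤ) (d : ℕ) {S : Finset α}
    {a a' : α → ℤ} (h : ∀ i ∈ S, a i = a' i) :
    eval f d S a = eval f d S a' := by
  refine sum_congr rfl fun I hI => ?_
  rw [prod_congr rfl fun i hi => h i ((mem_powersetCard.1 hI).1 hi)]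

theorem eval_eq_single {α : Type*} {f : Finset α → ℤ} {d : ℕ} {S I : Finset α}
    (a : α → ℤ) (hI : I ∈ powersetCard d S)
    (h : ∀ K ∈ powersetCard d S, K ≠ I → f K = 0) :
    eval f d S a = f I * ∏ i ∈ I, a i :=
  sum_eq_single_of_mem I hI fun K hK hne => by rw [h K hK hne, zero_mul]

theorem eval_insert {α : Type*} [DecidableEq α] (f : Finset α → ℤ) (d : ℕ)
    {T : Finset α} {x : α} (hx : x ∉ T) (a : α → ℤ) :
    eval f (d + 1) (insert x T) a =
      eval f (d + 1) T a +
        a x * eval (fun K => f (insert x K)) d T a := by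
  have hnot : ∀ {e : ℕ}, ∀ K ∈ powersetCard e T, x ∉ K := fun K hK h =>
    hx ((mem_powersetCard.1 hK).1 h)
  unfold eval
  rw [powersetCard_succ_insert hx, sum_union, sum_image, mul_sum]
  · congr 1
    refine sum_congr rfl fun K hK => ?_
    rw [prod_insert (hnot K hK)]
    ring
  · intro K hK L hL h
    rw [← erase_insert (hnot K hK), ← erase_insert (hnot L hL)]
    exact congrArg (fun s => s.erase x) h
  · rw [disjoint_left]
    intro K hK hK'
    obtain ⟨L, -, rfl⟩ := mem_image.1 hK'
    exact hnot _ hK (mem_insert_self x L)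

theorem sum_factorial_div_factorial_succ (d : ℕ) :
    ∑ k ∈ range (d + 1 + 1), (d + 1).factorial / k.factorial =
      (d + 1) * (∑ k ∈ range (d + 1), d.factorial / k.factorial) + 1 := by
  rw [sum_range_succ, Nat.div_self (Nat.factorial_pos _), mul_sum]
  congr 1
  refine sum_congr rfl fun k hk => ?_
  rw [Nat.factorial_succ,
    Nat.mul_div_assoc _ (Nat.factorial_dvd_factorial (Nat.lt_succ_iff.1 (mem_range.1 hk)))]

/-- Bézout's identity for `b` with a linear bound on the coefficients. -/
theorem exists_mul_add_mul_eq_of_isCoprime {p q b M : ℤ} (hpq : IsCoprime p q) (hq : q ≠ 0)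
    (hpM : |p| ≤ M) (hqM : |q| ≤ M) (hM : 1 ≤ M) (hb : b ≠ 0) :
    ∃ u v : ℤ, p * v + q * u = b ∧ |u| ≤ |b| * (2 * M) ∧ |v| ≤ |b| * (2 * M) := by
  obtain ⟨s, t, hst⟩ := hpq
  have hb1 : 1 ≤ |b| := Int.one_le_abs hb
  have hq0 : 0 < |q| := abs_pos.2 hq
  set v := (b * s) % q
  have hv0 : 0 ≤ v := Int.emod_nonneg _ hq
  have hvq : v < |q| := Int.emod_lt_abs _ hq
  have hdiv : b * s = q * (b * s / q) + v := (Int.mul_ediv_add_emod _ _).symm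
  set u := p * (b * s / q) + b * t with hu
  have huv : p * v + q * u = b := by
    have : v = b * s - q * (b * s / q) := by linarith
    rw [hu, this]
    linear_combination b * hst
  refine ⟨u, v, huv, ?_, ?_⟩
  · have h1 : |q| * |u| ≤ |q| * (|b| + |p|) := by
      rw [← abs_mul, show q * u = b - p * v by linarith]
      calc |b - p * v| ≤ |b| + |p * v| := abs_sub _ _
        _ = |b| + |p| * v := by rw [abs_mul, abs_of_nonneg hv0]
        _ ≤ |q| * (|b| + |p|) := by
          nlinarith [abs_nonneg p, abs_nonneg b, mul_le_mul_of_nonneg_left hvq.le (abs_nonneg p)]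
    have h2 := le_of_mul_le_mul_left h1 hq0
    nlinarith
  · rw [abs_of_nonneg hv0]
    nlinarith

theorem abs_prod_le_pow_card {α : Type*} {s : Finset α} {a : α → ℤ} {C : ℤ}
    (h : ∀ i, |a i| ≤ C) : |∏ i ∈ s, a i| ≤ C ^ s.card := by
  rw [abs_prod]
  exact (prod_le_prod (fun i _ => abs_nonneg _) fun i _ => h i).trans_eq (by simp)

/-- A multilinear form with pairwise coprime nonzero coefficients, at least two of which are
nonzero, represents every nonzero integer `b` at a point bounded in terms of `b`. -/
theorem exists_eval_eq {α : Type*} [DecidableEq α] {M : ℤ} (hM : 1 ≤ M) (d : ℕ) :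
    ∀ (S : Finset α) (f : Finset α → ℤ),
      (∀ I ∈ powersetCard d S, |f I| ≤ M) →
      (∀ I ∈ powersetCard d S, ∀ J ∈ powersetCard d S,
        I ≠ J → f I ≠ 0 → f J ≠ 0 → IsCoprime (f I) (f J)) →
      (∃ I ∈ powersetCard d S, ∃ J ∈ powersetCard d S, I ≠ J ∧ f I ≠ 0 ∧ f J ≠ 0) →
      ∀ b : ℤ, b ≠ 0 → ∃ a : α → ℤ, eval f d S a = b ∧
        ∀ i, |a i| ≤ |b| * (2 * M) ^ ∑ k ∈ range (d + 1), d.factorial / k.factorial := by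
  induction d with
  | zero =>
    rintro S f - - ⟨I, hI, J, hJ, hIJ, -⟩
    simp only [powersetCard_zero, mem_singleton] at hI hJ
    exact absurd (hI.trans hJ.symm) hIJ
  | succ d ih =>
    intro S
    induction S using Finset.strongInduction with
    | H S ihS =>
    intro f hfM hcop htwo b hb
    have hb1 : 1 ≤ |b| := Int.one_le_abs hb
    rw [sum_factorial_div_factorial_succ]
    set ν := ∑ k ∈ range (d + 1), d.factorial / k.factorial
    have hpow : ∀ e : ℕ, 1 ≤ (2 * M) ^ e := fun e => one_le_pow₀ (by linarith)
    by_cases hred : ∃ x ∈ S, ∃ I ∈ powersetCard (d + 1) (S.erase x),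
        ∃ J ∈ powersetCard (d + 1) (S.erase x), I ≠ J ∧ f I ≠ 0 ∧ f J ≠ 0
    · obtain ⟨x, hx, htwo'⟩ := hred
      have hsub := powersetCard_mono (n := d + 1) (erase_subset x S)
      obtain ⟨a, ha, hab⟩ := ihS (S.erase x) (erase_ssubset hx) f
        (fun I hI => hfM I (hsub hI)) (fun I hI J hJ => hcop I (hsub hI) J (hsub hJ)) htwo' b hb
      rw [sum_factorial_div_factorial_succ] at hab
      refine ⟨Function.update a x 0, ?_, fun i => ?_⟩
      · rw [← insert_erase hx, eval_insert _ _ (notMem_erase x S),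
          Function.update_self, zero_mul, add_zero, ← ha]
        exact eval_congr _ _ fun i hi =>
          Function.update_of_ne (ne_of_mem_erase hi) _ _
      · rcases eq_or_ne i x with rfl | hi
        · rw [Function.update_self, abs_zero]
          have := hpow ((d + 1) * ν + 1)
          positivity
        · rw [Function.update_of_ne hi]
          exact hab i
    obtain ⟨I, hI, J, hJ, hIJ, hfI, hfJ⟩ := htwo
    have hIc := (mem_powersetCard.1 hI).2
    have hJc := (mem_powersetCard.1 hJ).2
    obtain ⟨x, hxJ, hxI⟩ : ∃ x ∈ J, x ∉ I := not_subset.1 fun h =>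
      hIJ (eq_of_subset_of_card_le h (by rw [hIc, hJc])).symm
    obtain ⟨y, hyI, hyJ⟩ : ∃ y ∈ I, y ∉ J := not_subset.1 fun h =>
      hIJ (eq_of_subset_of_card_le h (by rw [hIc, hJc]))
    have hxS : x ∈ S := (mem_powersetCard.1 hJ).1 hxJ
    set T := S.erase x
    have hxT : x ∉ T := notMem_erase x S
    have hIT : I ∈ powersetCard (d + 1) T :=
      mem_powersetCard.2 ⟨subset_erase.2 ⟨(mem_powersetCard.1 hI).1, hxI⟩, hIc⟩
    have hH (a : α → ℤ) : eval f (d + 1) T a = f I * ∏ i ∈ I, a i := by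
      refine eval_eq_single a hIT fun K hK hKI => ?_
      by_contra hfK
      exact hred ⟨x, hxS, K, hK, I, hIT, hKI, hfK, hfI⟩
    have hins : ∀ K ∈ powersetCard d T, insert x K ∈ powersetCard (d + 1) S := fun K hK => by
      obtain ⟨hKT, hKc⟩ := mem_powersetCard.1 hK
      refine mem_powersetCard.2 ⟨insert_subset hxS (hKT.trans (erase_subset x S)), ?_⟩
      rw [card_insert_of_notMem fun h => hxT (hKT h), hKc]
    have hinj : ∀ K ∈ powersetCard d T, ∀ L ∈ powersetCard d T, K ≠ L →
        insert x K ≠ insert x L := fun K hK L hL hKL h => hKL <| by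
      rw [← erase_insert fun h => hxT ((mem_powersetCard.1 hK).1 h),
        ← erase_insert fun h => hxT ((mem_powersetCard.1 hL).1 h), h]
    have hsplit (a : α → ℤ) : eval f (d + 1) S a = f I * ∏ i ∈ I, a i +
        a x * eval (fun K => f (insert x K)) d T a := by
      rw [← insert_erase hxS, eval_insert _ _ hxT, hH]
    have hJT : J.erase x ∈ powersetCard d T := mem_powersetCard.2
      ⟨erase_subset_erase x (mem_powersetCard.1 hJ).1, by rw [card_erase_of_mem hxJ, hJc]; rfl⟩
    by_cases hG : ∃ K ∈ powersetCard d T, K ≠ J.erase x ∧ f (insert x K) ≠ 0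
    · obtain ⟨K, hK, hKJ, hfK⟩ := hG
      obtain ⟨a, ha, hab⟩ := ih T (fun K => f (insert x K)) (fun K hK => hfM _ (hins K hK))
        (fun K hK L hL hKL => hcop _ (hins K hK) _ (hins L hL) (hinj K hK L hL hKL))
        ⟨K, hK, J.erase x, hJT, hKJ, hfK, by rwa [insert_erase hxJ]⟩ 1 one_ne_zero
      simp only [abs_one, one_mul] at hab
      have hprod : |∏ i ∈ I, a i| ≤ (2 * M) ^ ((d + 1) * ν) := by
        refine (abs_prod_le_pow_card hab).trans_eq ?_
        rw [hIc, ← pow_mul, mul_comm ν]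
      refine ⟨Function.update a x (b - f I * ∏ i ∈ I, a i), ?_, fun i => ?_⟩
      · rw [hsplit, prod_update_of_notMem hxI, Function.update_self,
          eval_congr _ d (a' := a) fun i hi =>
            Function.update_of_ne (ne_of_mem_erase hi) _ _, ha]
        ring
      · rcases eq_or_ne i x with rfl | hi
        · rw [Function.update_self]
          have h1 := hpow ((d + 1) * ν)
          calc |b - f I * ∏ i ∈ I, a i| ≤ |b| + |f I * ∏ i ∈ I, a i| := abs_sub _ _
            _ ≤ |b| + M * (2 * M) ^ ((d + 1) * ν) := by
              rw [abs_mul]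
              gcongr
              exact hfM I hI
            _ ≤ |b| * (2 * M) ^ ((d + 1) * ν + 1) := by
              rw [pow_succ]
              set P := (2 * M) ^ ((d + 1) * ν)
              have h2 : 1 ≤ M * P := by nlinarith
              nlinarith
        · rw [Function.update_of_ne hi]
          calc |a i| ≤ (2 * M) ^ ν := hab i
            _ ≤ (2 * M) ^ ((d + 1) * ν + 1) :=
              pow_le_pow_right₀ (by linarith) (by nlinarith [Nat.zero_le (d * ν)])
            _ ≤ |b| * (2 * M) ^ ((d + 1) * ν + 1) :=
              le_mul_of_one_le_left (by linarith [hpow ((d + 1) * ν + 1)]) hb1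
    · push Not at hG
      have hGJ (a : α → ℤ) : eval (fun K => f (insert x K)) d T a =
          f J * ∏ i ∈ J.erase x, a i := by
        rw [eval_eq_single a hJT hG, insert_erase hxJ]
      obtain ⟨u, v, huv, hu, hv⟩ := exists_mul_add_mul_eq_of_isCoprime
        (hcop I hI J hJ hIJ hfI hfJ) hfJ (hfM I hI) (hfM J hJ) hM hb
      have hbound : |b| * (2 * M) ≤ |b| * (2 * M) ^ ((d + 1) * ν + 1) := by
        gcongr
        exact le_self_pow₀ (by linarith) (by omega)
      refine ⟨Function.update (Function.update 1 y v) x u, ?_, fun i => ?_⟩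
      · rw [hsplit, hGJ, prod_update_of_notMem hxI, prod_update_of_notMem (notMem_erase x J),
          prod_update_of_notMem fun h => hyJ (mem_of_mem_erase h), prod_update_of_mem hyI,
          Function.update_self, ← huv]
        simp
        ring
      · refine le_trans ?_ hbound
        rcases eq_or_ne i x with rfl | hi
        · rwa [Function.update_self]
        rw [Function.update_of_ne hi]
        rcases eq_or_ne i y with rfl | hi
        · rwa [Function.update_self]
        rw [Function.update_of_ne hi, Pi.one_apply, abs_one]
        nlinarith

end MultilinearForm

/-- Let `1 ≤ d ≤ n` and let `F(x) = ∑_{|I| = d} f_I ∏_{i ∈ I} x_i` be a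
coprime integer multilinear `(n,d)`-form whose nonzero coefficients are pairwise coprime.
Then for every integer `b` there is `a ∈ ℤⁿ` with `F(a) = b` and
`|a| ≤ |b| · (2|F|)^{ν_d}` where `ν_d = ∑_{k=0}^{d} d!/k!`. -/
theorem stmt_1 (n d : ℕ) (hn : 1 ≤ n) (hd : 1 ≤ d) (hdn : d ≤ n)
    (f : Finset (Fin n) → ℤ)
    (hcoprime :
      Finset.gcd (Finset.powersetCard d (Finset.univ : Finset (Fin n))) f = 1)
    (hpairwise :
      ∀ I ∈ Finset.powersetCard d (Finset.univ : Finset (Fin n)),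
        ∀ J ∈ Finset.powersetCard d (Finset.univ : Finset (Fin n)),
          I ≠ J → f I ≠ 0 → f J ≠ 0 → IsCoprime (f I) (f J)) :
    ∀ b : ℤ, ∃ a : Fin n → ℤ,
      (∑ I ∈ Finset.powersetCard d (Finset.univ : Finset (Fin n)),
        f I * ∏ i ∈ I, a i) = b ∧
      ∀ i : Fin n,
        |a i| ≤ |b| *
          ((2 * (((Finset.powersetCard d (Finset.univ : Finset (Fin n))).sup
              fun I => (f I).natAbs : ℕ) : ℤ)) ^
            (∑ k ∈ Finset.range (d + 1), d.factorial / k.factorial)) := by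
  intro b
  set M : ℤ := (((Finset.powersetCard d (Finset.univ : Finset (Fin n))).sup
    fun I => (f I).natAbs : ℕ) : ℤ) with hM
  rcases eq_or_ne b 0 with rfl | hb
  · refine ⟨0, Finset.sum_eq_zero fun I hI => ?_, fun i => by simp⟩
    have hI0 : I.Nonempty := Finset.card_pos.1 (by rw [(Finset.mem_powersetCard.1 hI).2]; exact hd)
    obtain ⟨i, hi⟩ := hI0
    rw [Finset.prod_eq_zero hi rfl, mul_zero]
  have hfM : ∀ I ∈ Finset.powersetCard d (Finset.univ : Finset (Fin n)), |f I| ≤ M := by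
    intro I hI
    rw [Int.abs_eq_natAbs, hM]
    exact_mod_cast Finset.le_sup (f := fun I => (f I).natAbs) hI
  obtain ⟨I, hI, hfI⟩ : ∃ I ∈ Finset.powersetCard d (Finset.univ : Finset (Fin n)), f I ≠ 0 := by
    by_contra! h
    rw [Finset.gcd_eq_zero_iff.2 h] at hcoprime
    exact zero_ne_one hcoprime
  have hM1 : 1 ≤ M := (Int.one_le_abs hfI).trans (hfM I hI)
  by_cases htwo : ∃ J ∈ Finset.powersetCard d (Finset.univ : Finset (Fin n)), J ≠ I ∧ f J ≠ 0
  · obtain ⟨J, hJ, hJI, hfJ⟩ := htwo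
    exact MultilinearForm.exists_eval_eq hM1 d Finset.univ f hfM hpairwise
      ⟨I, hI, J, hJ, hJI.symm, hfI, hfJ⟩ b hb
  push Not at htwo
  have hunit : IsUnit (f I) := by
    rw [isUnit_iff_dvd_one, ← hcoprime]
    refine Finset.dvd_gcd fun J hJ => ?_
    rcases eq_or_ne J I with rfl | hJI
    · exact dvd_rfl
    · rw [htwo J hJ hJI]
      exact dvd_zero _
  obtain ⟨x, hx⟩ : I.Nonempty :=
    Finset.card_pos.1 (by rw [(Finset.mem_powersetCard.1 hI).2]; exact hd)
  have hb1 : 1 ≤ |b| := Int.one_le_abs hb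
  refine ⟨Function.update 1 x (b * f I), ?_, fun i => ?_⟩
  · refine (MultilinearForm.eval_eq_single _ hI htwo).trans ?_
    rw [Finset.prod_update_of_mem hx]
    simp only [Pi.one_apply, Finset.prod_const_one, mul_one]
    linear_combination b * Int.isUnit_mul_self hunit
  · refine le_trans (b := |b|) ?_ (le_mul_of_one_le_right (abs_nonneg b)
      (one_le_pow₀ (by linarith)))
    rcases eq_or_ne i x with rfl | hi
    · rw [Function.update_self, abs_mul, Int.isUnit_iff_abs_eq.1 hunit, mul_one]
    · rwa [Function.update_of_ne hi, Pi.one_apply, abs_one]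
end

section
/- Let d ≥ 1 and n = d+1, and let F be a coprime integer multilinear (n,d)-form which has at least one pair of coprime coefficients, i.e., there exist distinct d-element subsets I, J of {1,…,n} with gcd(f_I, f_J) = 1. Then for every integer b there exists a ∈ ℤⁿ such that F(a) = b and |a| ≤ |b|·(2|F|)^{ν_d}, where ν_d = ∑_{k=0}^{d} d!/k!. In particular, F represents all integers. -/
open Finset in
/-- The recursion `ν_{d+1} = (d+1) ν_d + 1` for `ν_d = ∑_{k ≤ d} d!/k!`. -/
lemma sum_factorial_div_factorial_succ (d : ℕ) :
    ∑ k ∈ range (d + 2), (d + 1).factorial / k.factorial =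
      (∑ k ∈ range (d + 1), d.factorial / k.factorial) * (d + 1) + 1 := by
  rw [sum_range_succ, Nat.div_self (Nat.factorial_pos _), sum_mul]
  congr 1
  refine sum_congr rfl fun k hk => ?_
  rw [Nat.factorial_succ, mul_comm,
    Nat.div_mul_right_comm (Nat.factorial_dvd_factorial (by grind))]

/-- Coprime integers of absolute value at most `M` have Bézout coefficients of absolute value
at most `M`. -/
lemma exists_bezout_abs_le {u v M : ℤ} (h : IsCoprime u v) (hM : 1 ≤ M) (hu : |u| ≤ M)
    (hv : |v| ≤ M) : ∃ x y : ℤ, u * x + v * y = 1 ∧ |x| ≤ M ∧ |y| ≤ M := by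
  rcases eq_or_ne v 0 with rfl | hv0
  · rw [isCoprime_zero_right] at h
    exact ⟨u, 0, by simpa using Int.isUnit_mul_self h, hu, by simp; omega⟩
  obtain ⟨p, q, hpq⟩ := h
  have hvpos : 0 < |v| := abs_pos.mpr hv0
  have hx : |p % v| = p % v := abs_of_nonneg (Int.emod_nonneg p hv0)
  have hlt : p % v < |v| := Int.emod_lt_abs p hv0
  have hsol : u * (p % v) + v * (q + u * (p / v)) = 1 := by
    linear_combination hpq + u * Int.emod_add_mul_ediv p v
  refine ⟨p % v, q + u * (p / v), hsol, by omega, ?_⟩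
  set y := q + u * (p / v)
  have hvy : |v| * |y| ≤ 1 + |u| * (p % v) := by
    rw [← abs_mul, ← hx, ← abs_mul, eq_sub_of_add_eq' hsol]
    simpa using abs_sub (1 : ℤ) (u * (p % v))
  have hbound : |v| * |y| ≤ |v| * M := by
    nlinarith [abs_nonneg u, Int.emod_nonneg p hv0]
  exact le_of_mul_le_mul_left hbound hvpos

open Finset in
/-- A multilinear form of degree `d + 1` in the `d + 2` variables indexed by `S`, with
coefficients bounded by `M` of which two are coprime, represents every nonzero integer `b`
by a point of size at most `|b| (2M)^{ν_{d+1}}`. -/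
lemma exists_sum_mul_prod_erase_eq {ι : Type*} [DecidableEq ι] {g : ι → ℤ} {M : ℤ} (hM : 1 ≤ M)
    {i j : ι} (hij : i ≠ j) (hg : IsCoprime (g i) (g j)) (d : ℕ) (S : Finset ι)
    (hS : #S = d + 2) (hi : i ∈ S) (hj : j ∈ S) (hgM : ∀ k ∈ S, |g k| ≤ M) {b : ℤ}
    (hb : b ≠ 0) :
    ∃ a : ι → ℤ, ∑ k ∈ S, g k * ∏ l ∈ S.erase k, a l = b ∧
      ∀ k ∈ S, |a k| ≤ |b| * (2 * M) ^ ∑ k ∈ range (d + 2), (d + 1).factorial / k.factorial := by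
  induction d generalizing S b with
  | zero =>
    obtain rfl : {i, j} = S :=
      eq_of_subset_of_card_le (by grind) (by rw [hS, card_pair hij])
    obtain ⟨x, y, hxy, hx, hy⟩ := exists_bezout_abs_le hg hM (hgM i hi) (hgM j hj)
    have hexp : ∑ k ∈ range (0 + 2), (0 + 1).factorial / k.factorial = 2 := by decide
    have hM2 : M ≤ (2 * M) ^ 2 := by nlinarith
    refine ⟨fun k => if k = i then b * y else b * x, ?_, fun k _ => ?_⟩
    · have h₁ : ({i, j} : Finset ι).erase i = {j} := by grind
      have h₂ : ({i, j} : Finset ι).erase j = {i} := by grind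
      rw [sum_pair hij, h₁, h₂]
      simp only [prod_singleton, if_neg hij.symm, if_true]
      linear_combination b * hxy
    · rw [hexp]
      dsimp only
      split_ifs <;> rw [abs_mul] <;> gcongr <;> omega
  | succ d ih =>
    obtain ⟨m, hm, hmij⟩ : ∃ m ∈ S, m ∉ ({i, j} : Finset ι) := by
      apply exists_mem_notMem_of_card_lt_card
      rw [card_pair hij, hS]
      omega
    obtain ⟨hmi, hmj⟩ : m ≠ i ∧ m ≠ j := by simpa using hmij
    have hT : #(S.erase m) = d + 2 := by rw [card_erase_of_mem hm, hS]; rfl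
    obtain ⟨a, ha, haM⟩ := ih (S.erase m) hT (by grind) (by grind)
      (fun k hk => hgM k (mem_of_mem_erase hk)) one_ne_zero
    set ν := ∑ k ∈ range (d + 2), (d + 1).factorial / k.factorial
    have hν : ∑ k ∈ range (d + 1 + 2), (d + 1 + 1).factorial / k.factorial = ν * (d + 2) + 1 :=
      sum_factorial_div_factorial_succ (d + 1)
    rw [hν]
    set P := ∏ l ∈ S.erase m, a l
    set X := (2 * M) ^ (ν * (d + 2))
    have hX : 1 ≤ X := one_le_pow₀ (by omega)
    have hb1 : 1 ≤ |b| := Int.one_le_abs hb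
    have hP : |P| ≤ X := by
      rw [abs_prod]
      calc ∏ l ∈ S.erase m, |a l| ≤ ∏ _l ∈ S.erase m, (2 * M) ^ ν :=
            prod_le_prod (fun l _ => abs_nonneg (a l)) fun l hl => by simpa using haM l hl
        _ = X := by rw [prod_const, hT, ← pow_mul]
    refine ⟨Function.update a m (b - g m * P), ?_, fun k hk => ?_⟩
    · rw [← add_sum_erase S _ hm, prod_congr rfl fun l hl =>
        Function.update_of_ne (ne_of_mem_erase hl) (b - g m * P) a]
      have hrest : ∀ k ∈ S.erase m,
          g k * ∏ l ∈ S.erase k, Function.update a m (b - g m * P) l =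
            (g k * ∏ l ∈ (S.erase m).erase k, a l) * (b - g m * P) := by
        intro k hk
        have hmk : m ∈ S.erase k := by grind
        rw [← mul_prod_erase _ _ hmk, Function.update_self,
          prod_congr rfl fun l hl => Function.update_of_ne (ne_of_mem_erase hl) (b - g m * P) a,
          erase_right_comm]
        ring
      rw [sum_congr rfl hrest, ← sum_mul, ha]
      ring
    · rw [pow_succ]
      by_cases hkm : k = m
      · subst hkm
        rw [Function.update_self]
        calc |b - g k * P| ≤ |b| + |g k| * |P| := by
              simpa [abs_mul] using abs_sub b (g k * P)
          _ ≤ |b| + M * X := by gcongr; exact hgM k hk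
          _ ≤ |b| * (M * X) + |b| * (M * X) := by
              have hMX : 1 ≤ M * X := one_le_mul_of_one_le_of_one_le hM hX
              exact add_le_add (le_mul_of_one_le_right (by omega) hMX)
                (le_mul_of_one_le_left (by omega) hb1)
          _ = |b| * (X * (2 * M)) := by ring
      · rw [Function.update_of_ne hkm]
        calc |a k| ≤ (2 * M) ^ ν := by simpa using haM k (by grind)
          _ ≤ X := pow_le_pow_right₀ (by omega) (Nat.le_mul_of_pos_right _ (by omega))
          _ ≤ |b| * (X * (2 * M)) := by
              refine (le_mul_of_one_le_right (by omega) (by omega : 1 ≤ 2 * M)).trans ?_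
              exact le_mul_of_one_le_left (by nlinarith) hb1

open Finset in
/-- The subsets of size `d` of a set of size `d + 1` are the complements of single points. -/
lemma powersetCard_univ_eq_image_erase {α : Type*} [Fintype α] [DecidableEq α] {d : ℕ}
    (h : Fintype.card α = d + 1) :
    powersetCard d (univ : Finset α) = univ.image (univ.erase ·) := by
  ext I
  simp only [mem_powersetCard_univ, mem_image, mem_univ, true_and]
  constructor
  · intro hI
    obtain ⟨k, hk⟩ := card_eq_one.mp (by rw [card_compl, hI, h]; omega : #Iᶜ = 1)
    exact ⟨k, by rw [← compl_singleton, ← hk, compl_compl]⟩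
  · rintro ⟨k, rfl⟩
    rw [card_erase_of_mem (mem_univ k), card_univ, h]
    rfl


/-- Let `d ≥ 1`, `n = d + 1`, and let
`F(x) = ∑_{|I| = d} f_I ∏_{i ∈ I} x_i` be a coprime integer multilinear `(n,d)`-form
having a pair of coprime coefficients.  Then for every integer `b` there is `a ∈ ℤⁿ` with
`F(a) = b` and `|a| ≤ |b| · (2|F|)^{ν_d}` where `ν_d = ∑_{k=0}^{d} d!/k!`.  In particular
`F` represents all integers. -/
theorem stmt_2 (d n : ℕ) (hd : 1 ≤ d) (hn : n = d + 1)
    (f : Finset (Fin n) → ℤ)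
    (hcoprime :
      Finset.gcd (Finset.powersetCard d (Finset.univ : Finset (Fin n))) f = 1)
    (hpair :
      ∃ I ∈ Finset.powersetCard d (Finset.univ : Finset (Fin n)),
        ∃ J ∈ Finset.powersetCard d (Finset.univ : Finset (Fin n)),
          I ≠ J ∧ IsCoprime (f I) (f J)) :
    ∀ b : ℤ, ∃ a : Fin n → ℤ,
      (∑ I ∈ Finset.powersetCard d (Finset.univ : Finset (Fin n)),
        f I * ∏ i ∈ I, a i) = b ∧
      ∀ i : Fin n,
        |a i| ≤ |b| *
          ((2 * (((Finset.powersetCard d (Finset.univ : Finset (Fin n))).sup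
              fun I => (f I).natAbs : ℕ) : ℤ)) ^
            (∑ k ∈ Finset.range (d + 1), d.factorial / k.factorial)) := by
  intro b
  obtain ⟨e, rfl⟩ : ∃ e, d = e + 1 := ⟨d - 1, by omega⟩
  have himage := powersetCard_univ_eq_image_erase (α := Fin n) (by rw [Fintype.card_fin, hn])
  set M := (Finset.powersetCard (e + 1) (Finset.univ : Finset (Fin n))).sup
    fun I => (f I).natAbs
  rcases eq_or_ne b 0 with rfl | hb
  · refine ⟨0, Finset.sum_eq_zero fun I hI => ?_, by simp⟩
    have hcard : I.card = e + 1 := (Finset.mem_powersetCard.mp hI).2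
    simp [Finset.prod_const, hcard]
  obtain ⟨I, hI, J, hJ, hIJ, hfIJ⟩ := hpair
  have hM : ∀ K ∈ Finset.powersetCard (e + 1) (Finset.univ : Finset (Fin n)),
      |f K| ≤ (M : ℤ) := by
    intro K hK
    rw [Int.abs_eq_natAbs]
    exact_mod_cast Finset.le_sup (f := fun I => (f I).natAbs) hK
  have hM1 : 1 ≤ (M : ℤ) := by
    by_contra hlt
    have hzero : ∀ K ∈ Finset.powersetCard (e + 1) (Finset.univ : Finset (Fin n)), f K = 0 :=
      fun K hK => abs_nonpos_iff.mp ((hM K hK).trans (by omega))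
    rw [hzero I hI, hzero J hJ] at hfIJ
    exact not_isCoprime_zero_zero hfIJ
  rw [himage] at hI hJ hM ⊢
  obtain ⟨i, -, rfl⟩ := Finset.mem_image.mp hI
  obtain ⟨j, -, rfl⟩ := Finset.mem_image.mp hJ
  obtain ⟨a, ha, haM⟩ := exists_sum_mul_prod_erase_eq (g := fun k => f (Finset.univ.erase k))
    hM1 (fun h => hIJ (by rw [h])) hfIJ e Finset.univ (by rw [Finset.card_fin, hn])
    (Finset.mem_univ i) (Finset.mem_univ j)
    (fun k _ => hM _ (Finset.mem_image_of_mem _ (Finset.mem_univ k))) hb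
  refine ⟨a, ?_, fun k => haM k (Finset.mem_univ k)⟩
  rw [Finset.sum_image fun k _ l _ h => (Finset.erase_inj _ (Finset.mem_univ k)).mp h]
  exact ha
end

section
/- Let p ≥ 5 be an integer such that neither 2 nor 3 divides p. Then the polynomial F(x,y,z) = 6xy + 2p·xz + 3p·yz represents every integer: for every b ∈ ℤ there exist integers x, y, z with 6xy + 2pxz + 3pyz = b. -/
/-- With `u = 2x`, `v = 3y`, `w = pz` the form is `uv + uw + vw = (u + w)(v + w) - w²`, so a suitable
factorization of `b + w²` gives a representation of `b`. -/
theorem exists_represents_of_mul_eq {p b z r s : ℤ} (h : r * s = b + (p * z) ^ 2)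
    (hr : 2 ∣ r - p * z) (hs : 3 ∣ s - p * z) :
    ∃ x y z : ℤ, 6 * x * y + 2 * p * x * z + 3 * p * y * z = b := by
  obtain ⟨x, hx⟩ := hr
  obtain ⟨y, hy⟩ := hs
  obtain rfl : r = 2 * x + p * z := by linarith
  obtain rfl : s = 3 * y + p * z := by linarith
  exact ⟨x, y, z, by linarith⟩

/-- An integer prime to `6` has a multiple in every residue class modulo `18`. -/
theorem exists_mul_eq_add_eighteen_mul {p : ℤ} (h2 : ¬ 2 ∣ p) (h3 : ¬ 3 ∣ p) (t : ℤ) :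
    ∃ z m : ℤ, p * z = t + 18 * m := by
  have c2 : IsCoprime (2 : ℤ) p := (Prime.coprime_iff_not_dvd Int.prime_two).2 h2
  have c3 : IsCoprime (3 : ℤ) p := (Prime.coprime_iff_not_dvd Int.prime_three).2 h3
  obtain ⟨u, v, huv⟩ := c2.mul_left (c3.mul_left c3)
  exact ⟨v * t, -(u * t), by linear_combination t * huv⟩

/-- If `p ≥ 5` is an integer divisible by neither `2` nor `3`, then the
polynomial `F(x,y,z) = 6xy + 2p·xz + 3p·yz` represents every integer. -/
theorem stmt_3 (p : ℤ) (hp : 5 ≤ p) (h2 : ¬ (2 ∣ p)) (h3 : ¬ (3 ∣ p)) :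
    ∀ b : ℤ, ∃ x y z : ℤ, 6 * x * y + 2 * p * x * z + 3 * p * y * z = b := by
  intro b
  have residue := exists_mul_eq_add_eighteen_mul h2 h3
  have cases_mod : b % 2 = 0 ∨ (b % 2 = 1 ∧ b % 3 = 0) ∨ (b % 2 = 1 ∧ b % 3 = 1) ∨
      b % 9 = 2 ∨ b % 9 = 5 ∨ b % 9 = 8 := by omega
  have factor_three : ∀ t : ℤ, t % 6 = 1 → (b + t ^ 2) % 9 = 3 →
      ∃ x y z : ℤ, 6 * x * y + 2 * p * x * z + 3 * p * y * z = b := by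
    intro t ht hb
    obtain ⟨z, m, hz⟩ := residue t
    have hsq : (p * z) ^ 2 = t ^ 2 + 9 * (4 * t * m + 36 * m ^ 2) := by rw [hz]; ring
    exact exists_represents_of_mul_eq (z := z) (r := 3) (s := (b + (p * z) ^ 2) / 3)
      (by omega) (by omega) (by omega)
  rcases cases_mod with h | h | h | h | h | h
  · obtain ⟨z, m, hz⟩ := residue 1
    have hsq : (p * z) ^ 2 = 1 + 2 * (18 * m + 162 * m ^ 2) := by rw [hz]; ring
    exact exists_represents_of_mul_eq (z := z) (r := b + (p * z) ^ 2) (s := 1)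
      (by ring) (by omega) (by omega)
  · obtain ⟨z, m, hz⟩ := residue 1
    have hsq : (p * z) ^ 2 = 1 + 3 * (12 * m + 108 * m ^ 2) := by rw [hz]; ring
    exact exists_represents_of_mul_eq (z := z) (r := 1) (s := b + (p * z) ^ 2)
      (by ring) (by omega) (by omega)
  · obtain ⟨z, m, hz⟩ := residue 5
    have hsq : (p * z) ^ 2 = 25 + 3 * (60 * m + 108 * m ^ 2) := by rw [hz]; ring
    exact exists_represents_of_mul_eq (z := z) (r := 1) (s := b + (p * z) ^ 2)
      (by ring) (by omega) (by omega)
  · exact factor_three 1 (by norm_num) (by omega)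
  · exact factor_three 13 (by norm_num) (by omega)
  · exact factor_three 7 (by norm_num) (by omega)
end

section
/- The polynomial F(x,y,z) = 6xy + 10xz + 15yz represents every integer: for every b ∈ ℤ there exist integers x, y, z with 6xy + 10xz + 15yz = b. (Note that the greatest common divisor of each pair of coefficients 6, 10, 15 is greater than 1, while gcd(6,10,15) = 1.) -/
/-- The polynomial `F(x,y,z) = 6xy + 10xz + 15yz` represents every integer. -/
theorem stmt_4 :
    ∀ b : ℤ, ∃ x y z : ℤ, 6 * x * y + 10 * x * z + 15 * y * z = b := by
  intro b
  have residues : b % 2 = 0 ∨ b % 4 = 1 ∨ b % 8 = 3 ∨ b % 16 = 7 ∨ b % 16 = 15 := by omega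
  rcases residues with h | h | h | h | h
  · exact ⟨(b + 30) / 2, 2, -1, by omega⟩
  · exact ⟨(b + 15) / 4, -1, 1, by omega⟩
  · exact ⟨(b + 45) / 8, 3, -1, by omega⟩
  · exact ⟨(b + 825) / 16, 11, -5, by omega⟩
  · exact ⟨(b - 15) / 16, 1, 1, by omega⟩
end

section
/- Let A = (a_{ij}) ∈ ℤ^{n×s} with 1 ≤ s < n, and consider the polynomial F in the n(n−s) variables y_{ij} (1 ≤ i ≤ n, 1 ≤ j ≤ n−s) given by F(y) = det of the n×n matrix whose first s columns are the columns of A and whose last n−s columns are the variables y_{ij}. Then F represents all integers (i.e., for every b ∈ ℤ there is an integer matrix y ∈ ℤ^{n×(n−s)} with F(y) = b) if and only if the s×s minors of A are coprime, i.e., the gcd of all determinants of s×s submatrices of A equals 1. -/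
open Matrix

/-- The determinant of a product `B * A`, expanded along the rows of `B`. -/
theorem Matrix.det_mul_eq_sum_prod_mul_det_submatrix {R m n : Type*} [CommRing R]
    [Fintype m] [DecidableEq m] [Fintype n] (B : Matrix m n R) (A : Matrix n m R) :
    (B * A).det = ∑ f : m → n, (∏ i, B i (f i)) * (A.submatrix f id).det := by
  classical
  have hrows : B * A = fun i => ∑ k, B i k • A k := by
    ext i j
    simp [Matrix.mul_apply]
  change detRowAlternating (B * A) = _
  rw [hrows]
  change (detRowAlternating (R := R) (n := m)).toMultilinearMap _ = _
  rw [MultilinearMap.map_sum]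
  refine Finset.sum_congr rfl fun f _ => ?_
  rw [MultilinearMap.map_smul_univ]
  rfl

/-- A matrix over `ℤ` has a left inverse if and only if its maximal minors are coprime. -/
theorem Matrix.exists_mul_eq_one_iff_gcd_det_submatrix {n s : ℕ} (A : Matrix (Fin n) (Fin s) ℤ) :
    (∃ B : Matrix (Fin s) (Fin n) ℤ, B * A = 1) ↔
      Finset.gcd (Finset.univ : Finset (Fin s ↪ Fin n))
        (fun r => (A.submatrix r id).det) = 1 := by
  constructor
  · rintro ⟨B, hB⟩
    rw [← Finset.normalize_gcd, normalize_eq_one]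
    refine isUnit_of_dvd_one ?_
    rw [← det_one (n := Fin s) (R := ℤ), ← hB, det_mul_eq_sum_prod_mul_det_submatrix]
    refine Finset.dvd_sum fun f _ => Dvd.dvd.mul_left ?_ _
    by_cases hf : Function.Injective f
    · exact Finset.gcd_dvd (f := fun r : Fin s ↪ Fin n => (A.submatrix r id).det)
        (Finset.mem_univ ⟨f, hf⟩)
    · obtain ⟨i, j, hij, hne⟩ := Function.not_injective_iff.mp hf
      rw [det_zero_of_row_eq hne (by ext k; simp [hij])]
      exact dvd_zero _
  · intro h
    obtain ⟨c, hc⟩ := Finset.gcd_eq_sum_mul (Finset.univ : Finset (Fin s ↪ Fin n))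
      fun r => (A.submatrix r id).det
    rw [h] at hc
    refine ⟨∑ r : Fin s ↪ Fin n,
      c r • ((A.submatrix r id).adjugate * (1 : Matrix (Fin n) (Fin n) ℤ).submatrix r id), ?_⟩
    have hrow (r : Fin s ↪ Fin n) :
        (1 : Matrix (Fin n) (Fin n) ℤ).submatrix r id * A = A.submatrix r id := by
      ext i j
      simp [Matrix.mul_apply, Matrix.one_apply]
    simp_rw [Matrix.sum_mul, Matrix.smul_mul, Matrix.mul_assoc, hrow, adjugate_mul, smul_smul,
      ← Finset.sum_smul]
    simp_rw [mul_comm (c _), ← hc, one_smul]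

/-- A left inverse of `A` yields a square matrix of unit determinant extending `A`. -/
theorem Matrix.exists_isUnit_det_of_mul_eq_one {n s : ℕ} (hsn : s ≤ n)
    {A : Matrix (Fin n) (Fin s) ℤ} {B : Matrix (Fin s) (Fin n) ℤ} (h : B * A = 1) :
    ∃ N : Matrix (Fin n) (Fin n) ℤ,
      N.submatrix id (Fin.castLE hsn) = A ∧ IsUnit N.det := by
  let K := LinearMap.ker B.mulVecLin
  let f : ((Fin s → ℤ) × K) →ₗ[ℤ] (Fin n → ℤ) := A.mulVecLin.coprod K.subtype
  have hBA (x : Fin s → ℤ) : B *ᵥ (A *ᵥ x) = x := by simp [h]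
  have hK (k : K) : B *ᵥ (k : Fin n → ℤ) = 0 := k.2
  have hf (x : Fin s → ℤ) (k : K) : f (x, k) = A *ᵥ x + k := rfl
  have hinj : Function.Injective f := by
    rw [injective_iff_map_eq_zero]
    rintro ⟨x, k⟩ hx
    rw [hf] at hx
    have hx0 : x = 0 := by simpa [mulVec_add, hBA, hK, -mulVec_mulVec] using congrArg (B *ᵥ ·) hx
    subst hx0
    simpa using hx
  have hsurj : Function.Surjective f := fun v =>
    ⟨(B *ᵥ v, ⟨v - A *ᵥ (B *ᵥ v), by
      simp [K, LinearMap.mem_ker, mulVec_sub, hBA, -mulVec_mulVec]⟩), by rw [hf]; simp⟩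
  let e := LinearEquiv.ofBijective f ⟨hinj, hsurj⟩
  have he (p : (Fin s → ℤ) × K) : e p = f p := rfl
  have hrank : Module.finrank ℤ K = n - s := by
    have := e.finrank_eq
    rw [Module.finrank_prod] at this
    simp at this
    omega
  let b := (((Pi.basisFun ℤ (Fin s)).prod (Module.finBasisOfFinrankEq ℤ K hrank)).map e).reindex
    (finSumFinEquiv.trans (finCongr (Nat.add_sub_cancel' hsn)))
  refine ⟨(Pi.basisFun ℤ (Fin n)).toMatrix b, ?_, ?_⟩
  · ext i j
    have hj : (finSumFinEquiv.trans (finCongr (Nat.add_sub_cancel' hsn))).symm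
        (Fin.castLE hsn j) = Sum.inl j := by
      rw [Equiv.symm_apply_eq]
      ext
      simp
    have hbj : b (Fin.castLE hsn j) = A *ᵥ Pi.single j 1 := by
      rw [Module.Basis.reindex_apply, hj]
      simp [he, hf]
    simp [Module.Basis.toMatrix_apply, hbj]
  · rw [← Module.Basis.det_apply]
    exact Module.Basis.isUnit_det _ _


/-- Let `A ∈ ℤ^{n×s}` with `1 ≤ s < n` and let `F(y)` be the determinant
of the `n×n` matrix whose first `s` columns are those of `A` and whose last `n−s` columns
are the variables `y`.  Then `F` represents all integers if and only if the `s×s` minors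
of `A` (row selections) are coprime. -/
theorem stmt_6 (n s : ℕ) (hs : 1 ≤ s) (hsn : s < n)
    (A : Matrix (Fin n) (Fin s) ℤ) :
    (∀ b : ℤ, ∃ y : Matrix (Fin n) (Fin (n - s)) ℤ,
        (Matrix.of fun i j : Fin n =>
          if h : (j : ℕ) < s then A i ⟨(j : ℕ), h⟩
          else y i ⟨(j : ℕ) - s, by have := j.isLt; omega⟩).det = b) ↔
      Finset.gcd (Finset.univ : Finset (Fin s ↪ Fin n))
        (fun r => (A.submatrix r id).det) = 1 := by

  rw [← exists_mul_eq_one_iff_gcd_det_submatrix]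
  constructor
  · intro h
    obtain ⟨y, hy⟩ := h 1
    set N := Matrix.of fun i j : Fin n =>
          if h : (j : ℕ) < s then A i ⟨(j : ℕ), h⟩
          else y i ⟨(j : ℕ) - s, by have := j.isLt; omega⟩ with hN
    have hA : N.submatrix id (Fin.castLE hsn.le) = A := by
      ext i j
      simp [hN]
    refine ⟨N⁻¹.submatrix (Fin.castLE hsn.le) id, ?_⟩
    conv_lhs => rw [← hA]
    rw [← submatrix_mul _ _ _ _ _ Function.bijective_id, nonsing_inv_mul _ (by simp [hy])]
    exact submatrix_one _ (Fin.castLE_injective _)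
  · rintro ⟨B, hB⟩ b
    obtain ⟨N, hNA, u, hu⟩ := exists_isUnit_det_of_mul_eq_one hsn.le hB
    let j₀ : Fin n := ⟨s, hsn⟩
    let N' := N.updateCol j₀ ((b * (u⁻¹ : ℤˣ)) • fun i => N i j₀)
    refine ⟨Matrix.of fun i k => N' i ⟨s + k, by omega⟩, ?_⟩
    trans N'.det
    · congr 1
      ext i j
      by_cases hj : (j : ℕ) < s
      · have hne : j ≠ j₀ := fun h => by simp [h, j₀] at hj
        simp [hj, N', hne, ← hNA]
      · simp [hj, Nat.add_sub_cancel' (not_lt.mp hj)]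
    · rw [det_updateCol_smul, updateCol_eq_self, ← hu]
      simp [mul_assoc]
end

section
/- Let A = (a_{ij}) ∈ ℤ^{r×s} with 1 ≤ s ≤ r ≤ n and s < n. Consider the polynomial F(x, y) in the variables x_{ij} (1 ≤ i ≤ n−r, 1 ≤ j ≤ s) and y_{ij} (1 ≤ i ≤ n, 1 ≤ j ≤ n−s), defined as the determinant of the n×n matrix whose upper-left r×s block is A, whose lower-left (n−r)×s block consists of the variables x_{ij}, and whose right n×(n−s) block consists of the variables y_{ij}. Then F represents all integers (for every b ∈ ℤ there exist integer values of the x's and y's with F(x,y) = b) if and only if one of the following holds: (i) r + s ≤ n, or (ii) r + s > n and the minors of order r+s−n of A are coprime (the gcd of all determinants of (r+s−n)×(r+s−n) submatrices of A equals 1). -/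
namespace Matrix

/-- Over a field, a matrix of rank at least `k` has `k` linearly independent rows. -/
theorem exists_linearIndependent_rows {K m n : Type*} [Field K] [Fintype m] [Fintype n]
    (A : Matrix m n K) {k : ℕ} (hk : k ≤ A.rank) :
    ∃ f : Fin k ↪ m, LinearIndependent K fun i => A (f i) := by
  obtain ⟨κ, a, ha, hspan, hli⟩ := exists_linearIndependent' K A.row
  have : Finite κ := Finite.of_injective a ha
  have := Fintype.ofFinite κ
  have hcard : A.rank = Fintype.card κ := by
    rw [rank_eq_finrank_span_row, ← hspan, finrank_span_eq_card hli]
  obtain ⟨g⟩ : Nonempty (Fin k ↪ κ) :=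
    Function.Embedding.nonempty_of_card_le (by simpa [← hcard] using hk)
  exact ⟨g.trans ⟨a, ha⟩, hli.comp g g.injective⟩

/-- Over a field, a matrix of rank at least `k` has a nonzero minor of order `k`. -/
theorem exists_submatrix_det_ne_zero {K m n : Type*} [Field K] [Fintype m] [Fintype n]
    (A : Matrix m n K) {k : ℕ} (hk : k ≤ A.rank) :
    ∃ (f : Fin k ↪ m) (g : Fin k ↪ n), (A.submatrix f g).det ≠ 0 := by
  obtain ⟨f, hf⟩ := A.exists_linearIndependent_rows hk
  have hrank : (A.submatrix f id).rank = k := by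
    have := LinearIndependent.rank_matrix (M := A.submatrix f id) hf
    simpa using this
  obtain ⟨g, hg⟩ := (A.submatrix f id)ᵀ.exists_linearIndependent_rows
    (k := k) (by rw [rank_transpose, hrank])
  refine ⟨f, g, ?_⟩
  have hunit : IsUnit (A.submatrix f g)ᵀ := linearIndependent_rows_iff_isUnit.1 hg
  rw [← det_transpose]
  exact ((isUnit_iff_isUnit_det _).1 hunit).ne_zero

/-- The rank of matrices is subadditive. -/
theorem rank_add_le {K m n : Type*} [Field K] [Finite m] [Fintype n] (A B : Matrix m n K) :
    (A + B).rank ≤ A.rank + B.rank := by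
  have hle : LinearMap.range (A + B).mulVecLin ≤
      LinearMap.range A.mulVecLin ⊔ LinearMap.range B.mulVecLin := by
    rintro _ ⟨v, rfl⟩
    rw [mulVecLin_apply, add_mulVec]
    exact Submodule.add_mem_sup ⟨v, rfl⟩ ⟨v, rfl⟩
  exact (Submodule.finrank_mono hle).trans (Submodule.finrank_add_le_finrank_add_finrank _ _)

/-- An integer matrix factors through any free module whose rank is at least its own. -/
theorem exists_eq_mul_of_rank_le {m n : Type*} [Finite m] [Fintype n] [DecidableEq n]
    (E : Matrix m n ℤ) {k : ℕ} (hk : E.rank ≤ k) :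
    ∃ (C : Matrix m (Fin k) ℤ) (X : Matrix (Fin k) n ℤ), C * X = E := by
  have := Fintype.ofFinite m
  obtain ⟨k, rfl⟩ := Nat.exists_eq_add_of_le hk
  let b : Module.Basis (Fin E.rank) ℤ (LinearMap.range E.mulVecLin) := Module.finBasis _ _
  let C : Matrix m (Fin E.rank) ℤ := of fun i j => (b j : m → ℤ) i
  let X : Matrix (Fin E.rank) n ℤ :=
    of fun i j => b.repr (E.mulVecLin.rangeRestrict (Pi.single j 1)) i
  have hCX : C * X = E := by
    ext i j
    have h := congrArg (fun v : LinearMap.range E.mulVecLin => (v : m → ℤ) i)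
      (b.sum_repr (E.mulVecLin.rangeRestrict (Pi.single j 1)))
    simp only [Submodule.coe_sum, Finset.sum_apply, Submodule.coe_smul, Pi.smul_apply] at h
    simpa [mul_apply, C, X, mul_comm] using h
  refine ⟨(fromCols C 0).submatrix id finSumFinEquiv.symm,
    (fromRows X 0).submatrix finSumFinEquiv.symm id, ?_⟩
  rw [submatrix_mul_equiv, fromCols_mul_fromRows, hCX]
  simp

/-- If `T * V = 1`, the complementary idempotent `1 - V * T` factors through the expected number
of dimensions. -/
theorem exists_mul_add_mul_eq_one {k m s : ℕ} (V : Matrix (Fin s) (Fin k) ℤ)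
    (T : Matrix (Fin k) (Fin s) ℤ) (hTV : T * V = 1) (hs : s ≤ k + m) :
    ∃ (C : Matrix (Fin s) (Fin m) ℤ) (X : Matrix (Fin m) (Fin s) ℤ), V * T + C * X = 1 := by
  have hrank : (1 - V * T).rank ≤ m := by
    have hle : LinearMap.range V.mulVecLin ≤ LinearMap.ker (1 - V * T).mulVecLin := by
      rintro _ ⟨v, rfl⟩
      rw [LinearMap.mem_ker, mulVecLin_apply, mulVecLin_apply, mulVec_mulVec, Matrix.sub_mul,
        Matrix.mul_assoc, hTV, Matrix.one_mul, Matrix.mul_one, sub_self, zero_mulVec]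
    have hV : k ≤ V.rank := by
      have := rank_mul_le_right T V
      rwa [hTV, rank_one, Fintype.card_fin] at this
    have hker := Submodule.finrank_mono hle
    have hsum := Submodule.finrank_quotient_add_finrank (LinearMap.ker (1 - V * T).mulVecLin)
    rw [Module.finrank_fin_fun, (LinearMap.quotKerEquivRange _).finrank_eq] at hsum
    simp only [rank] at hV ⊢
    omega
  obtain ⟨C, X, h⟩ := exists_eq_mul_of_rank_le _ hrank
  exact ⟨C, X, by rw [h]; abel⟩

/-- An integer matrix whose entries have no common prime factor takes the value one as a
bilinear form. -/
theorem exists_dotProduct_mulVec_eq_one {m n : Type*} [Fintype m] [Fintype n]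
    [DecidableEq m] [DecidableEq n]
    (A : Matrix m n ℤ) (hA : ∀ p : ℕ, p.Prime → ∃ i j, ¬ (p : ℤ) ∣ A i j) :
    ∃ u v, u ⬝ᵥ A *ᵥ v = 1 := by
  let P : ℕ → Prop := fun d => 0 < d ∧ ∃ u v, u ⬝ᵥ A *ᵥ v = (d : ℤ)
  have hP : ∃ d, P d := by
    obtain ⟨i, j, hij⟩ := hA 2 Nat.prime_two
    have hne : A i j ≠ 0 := fun h => hij (by simp [h])
    refine ⟨(A i j).natAbs, Int.natAbs_pos.2 hne, Pi.single i (A i j).sign, Pi.single j 1, ?_⟩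
    simp
  classical
  obtain ⟨hpos, u, v, huv⟩ := Nat.find_spec hP
  set d := Nat.find hP
  have hdvd_of_lt : ∀ u v, (u ⬝ᵥ A *ᵥ v) % (d : ℤ) = u ⬝ᵥ A *ᵥ v → u ⬝ᵥ A *ᵥ v = 0 := by
    intro u v h
    by_contra hne
    have h0 := Int.emod_nonneg (u ⬝ᵥ A *ᵥ v) (b := (d : ℤ)) (by omega)
    have h1 := Int.emod_lt_of_pos (u ⬝ᵥ A *ᵥ v) (b := (d : ℤ)) (by omega)
    exact Nat.find_min hP (m := (u ⬝ᵥ A *ᵥ v).toNat) (by omega) ⟨by omega, u, v, by omega⟩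
  have hright : ∀ u v w, u ⬝ᵥ A *ᵥ v = d → (d : ℤ) ∣ u ⬝ᵥ A *ᵥ w := by
    intro u v w h
    have key : u ⬝ᵥ A *ᵥ (w - (u ⬝ᵥ A *ᵥ w / d) • v) = (u ⬝ᵥ A *ᵥ w) % d := by
      rw [mulVec_sub, mulVec_smul, dotProduct_sub, dotProduct_smul, h, Int.emod_def, smul_eq_mul,
        mul_comm]
    have := hdvd_of_lt _ _ (by rw [key, Int.emod_emod])
    exact Int.dvd_of_emod_eq_zero (key ▸ this)
  have hleft : ∀ u v w, u ⬝ᵥ A *ᵥ v = d → (d : ℤ) ∣ w ⬝ᵥ A *ᵥ v := by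
    intro u v w h
    have key : (w - (w ⬝ᵥ A *ᵥ v / d) • u) ⬝ᵥ A *ᵥ v = (w ⬝ᵥ A *ᵥ v) % d := by
      rw [sub_dotProduct, smul_dotProduct, h, Int.emod_def, smul_eq_mul, mul_comm]
    have := hdvd_of_lt _ _ (by rw [key, Int.emod_emod])
    exact Int.dvd_of_emod_eq_zero (key ▸ this)
  have hall : ∀ w z, (d : ℤ) ∣ w ⬝ᵥ A *ᵥ z := by
    intro w z
    obtain ⟨a, ha⟩ := hleft u v w huv
    -- `u + (w - a • u)` still pairs with `v` to `d`, so it pairs with every vector into `d ℤ`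
    have h1 : (u + (w - a • u)) ⬝ᵥ A *ᵥ v = d := by
      rw [add_dotProduct, sub_dotProduct, smul_dotProduct, huv, ha, smul_eq_mul]; ring
    have h2 := hright _ _ z h1
    have h3 := hright _ _ z huv
    rw [add_dotProduct, sub_dotProduct, smul_dotProduct, smul_eq_mul] at h2
    have : w ⬝ᵥ A *ᵥ z = (u ⬝ᵥ A *ᵥ z + (w ⬝ᵥ A *ᵥ z - a * u ⬝ᵥ A *ᵥ z)) - u ⬝ᵥ A *ᵥ z
      + a * u ⬝ᵥ A *ᵥ z := by ring
    rw [this]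
    exact dvd_add (dvd_sub h2 h3) (h3.mul_left a)
  have hd : d = 1 := by
    by_contra hd
    obtain ⟨p, hp, hpd⟩ := Nat.exists_prime_and_dvd hd
    obtain ⟨i, j, hij⟩ := hA p hp
    have h := hall (Pi.single i 1) (Pi.single j 1)
    simp only [mulVec_single_one, single_one_dotProduct, col_apply] at h
    exact hij ((Int.natCast_dvd_natCast.2 hpd).trans h)
  exact ⟨u, v, by rw [huv, hd]; rfl⟩

/-- An integer matrix of rank at least `k` modulo every prime contains the identity matrix of
order `k` up to multiplication on both sides. -/
theorem exists_mul_mul_eq_one {r s : ℕ} (A : Matrix (Fin r) (Fin s) ℤ) (k : ℕ)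
    (hA : ∀ p : ℕ, p.Prime → k ≤ (A.map (Int.cast : ℤ → ZMod p)).rank) :
    ∃ (U : Matrix (Fin k) (Fin r) ℤ) (V : Matrix (Fin s) (Fin k) ℤ), U * A * V = 1 := by
  induction k with
  | zero => exact ⟨0, 0, Subsingleton.elim _ _⟩
  | succ k ih =>
    obtain ⟨U, V, hUV⟩ := ih fun p hp => (Nat.le_succ k).trans (hA p hp)
    have hent : ∀ p : ℕ, p.Prime → ∃ i j, ¬ (p : ℤ) ∣ (A - A * V * (U * A)) i j := by
      intro p hp
      have : Fact p.Prime := ⟨hp⟩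
      by_contra! h
      have hzero : A.map (Int.cast : ℤ → ZMod p) = (A * V * (U * A)).map Int.cast := by
        ext i j
        simpa [sub_eq_zero] using (ZMod.intCast_zmod_eq_zero_iff_dvd _ p).2 (h i j)
      have hle := hA p hp
      have hmul : (A * V * (U * A)).map (Int.cast : ℤ → ZMod p)
          = (A * V).map Int.cast * (U * A).map Int.cast :=
        Matrix.map_mul (f := Int.castRingHom (ZMod p))
      rw [hzero, hmul] at hle
      have h1 := (rank_mul_le_left ((A * V).map (Int.cast : ℤ → ZMod p))
        ((U * A).map Int.cast)).trans (rank_le_card_width _)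
      rw [Fintype.card_fin] at h1
      exact absurd (hle.trans h1) (by omega)
    obtain ⟨u, v, huv⟩ := exists_dotProduct_mulVec_eq_one _ hent
    let u' : Matrix Unit (Fin r) ℤ := replicateRow Unit u * (1 - A * V * U)
    let v' : Matrix (Fin s) Unit ℤ := (1 - V * U * A) * replicateCol Unit v
    have h12 : U * A * v' = 0 := by
      simp only [v', ← Matrix.mul_assoc, Matrix.mul_sub, hUV, Matrix.mul_one, Matrix.one_mul,
        sub_self, Matrix.zero_mul]
    have h21 : u' * A * V = 0 := by
      simp only [u', Matrix.mul_assoc, Matrix.sub_mul, Matrix.one_mul] at hUV ⊢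
      simp [hUV]
    have h22 : u' * A * v' = 1 := by
      have h : u' * A * v' = u' * A * replicateCol Unit v := by
        simp only [v', Matrix.sub_mul, Matrix.mul_sub, Matrix.one_mul, ← Matrix.mul_assoc, h21,
          Matrix.zero_mul, sub_zero]
      rw [h]
      ext i j
      have : u' * A = replicateRow Unit u * (A - A * V * (U * A)) := by
        simp only [u', Matrix.sub_mul, Matrix.mul_sub, Matrix.mul_one, Matrix.mul_assoc]
      rw [this, Matrix.mul_assoc]
      simpa [mul_apply, dotProduct, mulVec] using huv
    let e : Fin k ⊕ Unit ≃ Fin (k + 1) :=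
      (Equiv.sumCongr (Equiv.refl _) (Equiv.ofUnique Unit (Fin 1))).trans finSumFinEquiv
    refine ⟨(fromRows U u').submatrix e.symm id, (fromCols V v').submatrix id e.symm, ?_⟩
    have : (fromRows U u' * A * fromCols V v').submatrix e.symm e.symm = 1 := by
      rw [fromRows_mul, fromRows_mul_fromCols, hUV, h12, h21, h22, fromBlocks_one,
        submatrix_one_equiv]
    rw [← this]
    rfl

/-- Minors commute with reduction modulo `p`. -/
theorem map_intCast_submatrix_det {r s k : ℕ} (A : Matrix (Fin r) (Fin s) ℤ) (p : ℕ)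
    (f : Fin k ↪ Fin r) (g : Fin k ↪ Fin s) :
    ((A.map (Int.cast : ℤ → ZMod p)).submatrix f g).det = ((A.submatrix f g).det : ZMod p) :=
  ((Int.castRingHom (ZMod p)).map_det _).symm

/-- The minors of order `k` of an integer matrix are coprime if and only if the matrix has rank
at least `k` modulo every prime. -/
theorem gcd_minors_eq_one_iff {r s : ℕ} (A : Matrix (Fin r) (Fin s) ℤ) (k : ℕ) :
    Finset.gcd (Finset.univ : Finset ((Fin k ↪ Fin r) × (Fin k ↪ Fin s)))
        (fun q => (A.submatrix q.1 q.2).det) = 1 ↔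
      ∀ p : ℕ, p.Prime → k ≤ (A.map (Int.cast : ℤ → ZMod p)).rank := by
  constructor
  · intro h p hp
    have : Fact p.Prime := ⟨hp⟩
    by_contra hlt
    have hdvd : (p : ℤ) ∣ 1 := by
      rw [← h]
      refine Finset.dvd_gcd fun q _ => ?_
      rw [← ZMod.intCast_zmod_eq_zero_iff_dvd, ← map_intCast_submatrix_det]
      by_contra hdet
      have hrank := rank_of_det_ne_zero hdet
      rw [Fintype.card_fin] at hrank
      exact hlt (hrank.symm.le.trans (rank_submatrix_le _ _ _))
    exact hp.one_lt.ne' (by exact_mod_cast Int.eq_one_of_dvd_one (by positivity) hdvd)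
  · intro h
    rw [← Finset.normalize_gcd, normalize_eq_one, Int.isUnit_iff_natAbs_eq]
    by_contra hne
    obtain ⟨p, hp, hpd⟩ := Nat.exists_prime_and_dvd hne
    have : Fact p.Prime := ⟨hp⟩
    obtain ⟨f, g, hfg⟩ := exists_submatrix_det_ne_zero _ (h p hp)
    rw [map_intCast_submatrix_det, Ne, ZMod.intCast_zmod_eq_zero_iff_dvd] at hfg
    exact hfg ((Int.natCast_dvd.2 hpd).trans (Finset.gcd_dvd (Finset.mem_univ (f, g))))

/-- If stacking `m` rows below `A` produces a left invertible matrix with `s` columns, then `A`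
has rank at least `s - m` modulo every prime. -/
theorem le_rank_map_of_mul_add_mul_eq_one {r s m : ℕ} {A : Matrix (Fin r) (Fin s) ℤ}
    {x : Matrix (Fin m) (Fin s) ℤ} {B : Matrix (Fin s) (Fin r) ℤ} {C : Matrix (Fin s) (Fin m) ℤ}
    (h : B * A + C * x = 1) (p : ℕ) [Fact p.Prime] :
    s ≤ (A.map (Int.cast : ℤ → ZMod p)).rank + m := by
  have hmod := congrArg (Int.castRingHom (ZMod p)).mapMatrix h
  simp only [map_add, map_one, RingHom.mapMatrix_apply, Matrix.map_mul] at hmod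
  calc s = (1 : Matrix (Fin s) (Fin s) (ZMod p)).rank := by rw [rank_one, Fintype.card_fin]
    _ ≤ _ := by rw [← hmod]; exact rank_add_le _ _
    _ ≤ _ := add_le_add (rank_mul_le_right _ _)
      ((rank_mul_le_left _ _).trans ((rank_le_card_width _).trans_eq (Fintype.card_fin m)))

end Matrix

open Matrix

/-- Let `A ∈ ℤ^{r×s}` with `1 ≤ s ≤ r ≤ n`, `s < n`, and let `F(x,y)` be
the determinant of the `n×n` matrix whose upper-left `r×s` block is `A`, whose lower-left
`(n−r)×s` block is the variables `x`, and whose right `n×(n−s)` block is the variables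
`y`.  Then `F` represents all integers if and only if (i) `r + s ≤ n`, or (ii) `r + s > n`
and the minors of order `r + s − n` of `A` are coprime. -/
theorem stmt_7 (n r s : ℕ) (hs : 1 ≤ s) (hsr : s ≤ r) (hrn : r ≤ n) (hsn : s < n)
    (A : Matrix (Fin r) (Fin s) ℤ) :
    (∀ b : ℤ, ∃ (x : Matrix (Fin (n - r)) (Fin s) ℤ)
        (y : Matrix (Fin n) (Fin (n - s)) ℤ),
        (Matrix.of fun i j : Fin n =>
          if hj : (j : ℕ) < s then
            (if hi : (i : ℕ) < r then A ⟨(i : ℕ), hi⟩ ⟨(j : ℕ), hj⟩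
             else x ⟨(i : ℕ) - r, by have := i.isLt; omega⟩ ⟨(j : ℕ), hj⟩)
          else y i ⟨(j : ℕ) - s, by have := j.isLt; omega⟩).det = b) ↔
      (r + s ≤ n ∨
        (n < r + s ∧
          Finset.gcd
            (Finset.univ : Finset ((Fin (r + s - n) ↪ Fin r) × (Fin (r + s - n) ↪ Fin s)))
            (fun p => (A.submatrix p.1 p.2).det) = 1)) := by
  rw [gcd_minors_eq_one_iff]
  let eR : Fin r ⊕ Fin (n - r) ≃ Fin n := finSumFinEquiv.trans (finCongr (by omega))
  let eS : Fin s ⊕ Fin (n - s) ≃ Fin n := finSumFinEquiv.trans (finCongr (by omega))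
  constructor
  · intro h
    refine or_iff_not_imp_left.2 fun hlt => ⟨by omega, fun p hp => ?_⟩
    have : Fact p.Prime := ⟨hp⟩
    obtain ⟨x, y, hxy⟩ := h 1
    set G : Matrix (Fin n) (Fin n) ℤ := Matrix.of _ with hG
    have hcols : G.submatrix eR (eS ∘ Sum.inl) = fromRows A x := by
      ext (i | i) j <;> simp [hG, eR, eS]
    have hinv : G⁻¹ * G = 1 := nonsing_inv_mul _ (by simp [hxy])
    have hone : G⁻¹.submatrix (eS ∘ Sum.inl) eR * G.submatrix eR (eS ∘ Sum.inl) = 1 := by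
      rw [submatrix_mul_equiv, hinv, submatrix_one _ (eS.injective.comp Sum.inl_injective)]
    rw [hcols, ← fromCols_toCols (G⁻¹.submatrix (eS ∘ Sum.inl) eR), fromCols_mul_fromRows] at hone
    have := le_rank_map_of_mul_add_mul_eq_one hone p
    omega
  · intro h b
    have hA : ∀ p : ℕ, p.Prime → r + s - n ≤ (A.map (Int.cast : ℤ → ZMod p)).rank := by
      rcases h with h | h
      · simp [Nat.sub_eq_zero_of_le h]
      · exact h.2
    obtain ⟨U, V, hUV⟩ := exists_mul_mul_eq_one A _ hA
    obtain ⟨C, x, hx⟩ := exists_mul_add_mul_eq_one (m := n - r) V (U * A) hUV (by omega)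
    let M : Matrix (Fin n) (Fin s) ℤ := (fromRows A x).submatrix eR.symm id
    let L : Matrix (Fin s) (Fin n) ℤ := (fromCols (V * U) C).submatrix id eR.symm
    have hLM : L * M = 1 := by
      rw [submatrix_mul_equiv, fromCols_mul_fromRows, Matrix.mul_assoc, hx, submatrix_id_id]
    obtain ⟨Y, W, hYW⟩ := exists_mul_add_mul_eq_one (m := n - s) M L hLM (by omega)
    let G : Matrix (Fin n) (Fin n) ℤ := (fromCols M Y).submatrix id eS.symm
    have hunit : IsUnit G.det := by
      refine (isUnit_iff_isUnit_det _).1 (IsUnit.of_mul_eq_one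
        ((fromRows L W).submatrix eS.symm id) ?_)
      rw [submatrix_mul_equiv, fromCols_mul_fromRows, hYW, submatrix_id_id]
    obtain ⟨c, hc⟩ := hunit.exists_left_inv
    let j₀ : Fin (n - s) := ⟨0, by omega⟩
    refine ⟨x, Y.updateCol j₀ ((b * c) • Y.col j₀), ?_⟩
    have hdet : (G.updateCol (eS (Sum.inr j₀)) ((b * c) • G.col (eS (Sum.inr j₀)))).det = b := by
      have hself : G.updateCol (eS (Sum.inr j₀)) (G.col (eS (Sum.inr j₀))) = G :=
        updateCol_eq_self _ _
      rw [det_updateCol_smul, hself, mul_assoc, hc, mul_one]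
    refine Eq.trans (congrArg det ?_) hdet
    ext i j
    obtain ⟨j, rfl⟩ := eS.surjective j
    rcases j with j | j
    · rw [updateCol_ne (eS.injective.ne Sum.inl_ne_inr)]
      obtain ⟨i | i, rfl⟩ := eR.surjective i <;> simp [G, M, eR, eS]
    · have hj : eS (Sum.inr j) = eS (Sum.inr j₀) ↔ j = j₀ := by simp
      simp only [updateCol_apply, hj]
      simp [G, eS]
end

section
/- Let n > m ≥ 1 and let L₁(x), …, L_m(x) be integer linear forms in n variables x₁,…,xₙ, with A ∈ ℤ^{m×n} the matrix whose rows are the coefficient vectors of L₁,…,L_m. Suppose the m×m minors of A are coprime (the gcd of all determinants of m×m submatrices of A equals 1). Then the polynomial F(x) = ∏_{i=1}^m L_i(x) represents all integers. Moreover, for each b ∈ ℤ, setting bᵥ = (b,1,…,1)ᵀ ∈ ℤ^m and μ(A,b) the maximum of the absolute values of the m×m minors of the augmented matrix (A | bᵥ), there exists a ∈ ℤⁿ with F(a) = b and |a| ≤ μ(A,b). -/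
/-- In a finite abelian group, a list of elements whose sum is `g` can be shortened to one of
length less than the order of the group. -/
theorem exists_list_sum_map_eq_and_length_lt {ι G : Type*} [AddCommGroup G] [Finite G]
    (f : ι → G) (l : List ι) :
    ∃ l' : List ι, (l'.map f).sum = (l.map f).sum ∧ l'.length < Nat.card G := by
  classical
  induction h : l.length using Nat.strong_induction_on generalizing l with
  | _ k ih =>
    subst h
    by_cases hl : l.length < Nat.card G
    · exact ⟨l, rfl, hl⟩
    have hnot : ¬ Function.Injective
        (fun i : Fin (l.length + 1) => ((l.take i).map f).sum) := by
      intro hinj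
      have := Nat.card_le_card_of_injective _ hinj
      simp at this
      omega
    obtain ⟨i, j, hij, hlt⟩ : ∃ i j : Fin (l.length + 1),
        ((l.take i).map f).sum = ((l.take j).map f).sum ∧ i < j := by
      simp only [Function.Injective, not_forall] at hnot
      obtain ⟨i, j, hij, hne⟩ := hnot
      rcases lt_or_gt_of_ne hne with h | h
      · exact ⟨i, j, hij, h⟩
      · exact ⟨j, i, hij.symm, h⟩
    have hj : (j : ℕ) ≤ l.length := by omega
    have hlt' : (i : ℕ) < j := hlt
    obtain ⟨l', hsum, hlen⟩ := ih (l.take i ++ l.drop j).length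
      (by simp only [List.length_append, List.length_take, List.length_drop]; omega) _ rfl
    refine ⟨l', ?_, hlen⟩
    rw [hsum, List.map_append, List.sum_append, hij, ← List.sum_append, ← List.map_append,
      List.take_append_drop]

/-- In a finite abelian group, an integral combination of elements equals one with nonnegative
coefficients whose sum is less than the order of the group. -/
theorem exists_nat_combination_sum_lt_card {ι G : Type*} [Fintype ι] [AddCommGroup G] [Finite G]
    (f : ι → G) (x : ι → ℤ) :
    ∃ y : ι → ℕ, ∑ i, y i • f i = ∑ i, x i • f i ∧ ∑ i, y i < Nat.card G := by
  classical
  have hpos : (0 : ℤ) < Nat.card G := by exact_mod_cast Nat.card_pos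
  have hmod : ∀ i, (x i % Nat.card G).toNat • f i = x i • f i := by
    intro i
    rw [← natCast_zsmul, Int.toNat_of_nonneg (Int.emod_nonneg _ hpos.ne')]
    conv_rhs => rw [← Int.emod_add_mul_ediv (x i) (Nat.card G), add_zsmul, mul_comm, mul_zsmul,
      natCast_zsmul, card_nsmul_eq_zero', zsmul_zero, add_zero]
  have hcount : ∀ l : List ι, (l.map f).sum = ∑ i, l.count i • f i := fun l =>
    Finset.sum_list_map_count l f |>.trans
      (Finset.sum_subset (Finset.subset_univ _) fun i _ hi => by
        rw [List.count_eq_zero_of_not_mem (by simpa using hi), zero_smul])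
  obtain ⟨l', hsum, hlen⟩ := exists_list_sum_map_eq_and_length_lt f
    (∑ i, (x i % Nat.card G).toNat • ({i} : Multiset ι)).toList
  refine ⟨fun i => l'.count i, ?_, ?_⟩
  · rw [← hcount, hsum, hcount]
    refine Finset.sum_congr rfl fun i _ => ?_
    rw [← hmod, ← Multiset.coe_count, Multiset.coe_toList, Multiset.count_sum']
    simp [Multiset.count_singleton]
  · refine lt_of_eq_of_lt ?_ hlen
    have := Multiset.sum_count_eq_card (s := Finset.univ) (m := (l' : Multiset ι)) (by simp)
    simpa using this

namespace Matrix

/-- The cokernel of a nonsingular square integer matrix has order the absolute value of its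
determinant. -/
theorem card_quotient_range_mulVecLin {m : Type*} [Fintype m] [DecidableEq m]
    (B : Matrix m m ℤ) (hB : B.det ≠ 0) :
    Nat.card ((m → ℤ) ⧸ B.mulVecLin.range) = B.det.natAbs := by
  have hinj : Function.Injective B.mulVecLin := by
    rw [← LinearMap.ker_eq_bot, LinearMap.ker_eq_bot']
    exact fun x hx => eq_zero_of_mulVec_eq_zero hB hx
  rw [← Submodule.natAbs_det_equiv _ (LinearEquiv.ofInjective _ hinj)]
  congr 1
  exact LinearMap.det_toLin' B

/-- An integer matrix whose maximal minors are coprime induces a surjective map. -/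
theorem exists_mulVec_eq_of_gcd_minors_eq_one {m n : Type*} [Fintype m] [DecidableEq m]
    [Fintype n] [DecidableEq n] (A : Matrix m n ℤ)
    (hA : Finset.gcd (Finset.univ : Finset (m ↪ n)) (fun c => (A.submatrix id c).det) = 1)
    (v : m → ℤ) : ∃ x, A *ᵥ x = v := by
  obtain ⟨w, hw⟩ := Finset.gcd_eq_sum_mul Finset.univ
    (fun c : m ↪ n => (A.submatrix id c).det)
  have hmem : ∀ c : m ↪ n, (A.submatrix id c).det • v ∈ A.mulVecLin.range := by
    intro c
    rw [← mulVec_cramer]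
    refine ⟨fun j => ∑ k, if c k = j then (A.submatrix id c).cramer v k else 0, ?_⟩
    ext i
    simp only [mulVecLin_apply, mulVec, dotProduct, Finset.mul_sum]
    rw [Finset.sum_comm]
    simp
  have : v = ∑ c : m ↪ n, w c • (A.submatrix id c).det • v := by
    simp_rw [smul_smul]
    rw [← Finset.sum_smul]
    have : (∑ c : m ↪ n, w c * (A.submatrix id c).det) = 1 := by
      rw [← hA, hw]
      simp only [mul_comm]
    rw [this, one_smul]
  have hv : v ∈ A.mulVecLin.range := by
    rw [this]
    exact Submodule.sum_mem _ fun c _ => Submodule.smul_mem _ _ (hmem c)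
  exact hv

/-- A bound on the minors at injective column selections holds at all column selections. -/
theorem natAbs_det_submatrix_le {m n : Type*} [Fintype m] [DecidableEq m]
    (A : Matrix m n ℤ) {V : ℕ} (hV : ∀ c : m ↪ n, (A.submatrix id c).det.natAbs ≤ V)
    (f : m → n) : (A.submatrix id f).det.natAbs ≤ V := by
  by_cases hf : Function.Injective f
  · exact hV ⟨f, hf⟩
  · simp only [Function.Injective, not_forall] at hf
    obtain ⟨i, j, hij, hne⟩ := hf
    rw [det_zero_of_column_eq hne (by simp [hij])]
    simp

/-- Replacing a column of a square submatrix of `A` by `A *ᵥ x` expands the determinant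
linearly. -/
theorem det_updateCol_submatrix_mulVec {m n : Type*} [Fintype m] [DecidableEq m]
    [Fintype n] (A : Matrix m n ℤ) (c : m → n) (i : m) (x : n → ℤ) :
    ((A.submatrix id c).updateCol i (A *ᵥ x)).det =
      ∑ k, x k * (A.submatrix id (Function.update c i k)).det := by
  have hx : A *ᵥ x = ∑ k, x k • fun r => A r k := by
    ext r
    simp [mulVec, dotProduct, mul_comm]
  rw [← cramer_apply, hx, map_sum, Finset.sum_apply]
  refine Finset.sum_congr rfl fun k _ => ?_
  rw [map_smul, Pi.smul_apply, smul_eq_mul, cramer_apply]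
  congr 2
  ext r s
  by_cases h : s = i
  · subst h; simp
  · simp [h]

/-- An integer system whose coefficient matrix has coprime maximal minors has a solution bounded
by any bound for the maximal minors of the augmented matrix. -/
theorem exists_mulVec_eq_natAbs_le {m n : Type*} [Fintype m] [DecidableEq m]
    [Fintype n] [DecidableEq n] (A : Matrix m n ℤ)
    (hA : Finset.gcd (Finset.univ : Finset (m ↪ n)) (fun c => (A.submatrix id c).det) = 1)
    (v : m → ℤ) (M : ℕ) (hM : ∀ c : m ↪ n, (A.submatrix id c).det.natAbs ≤ M)
    (hMv : ∀ (c : m ↪ n) (i : m), ((A.submatrix id c).updateCol i v).det.natAbs ≤ M) :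
    ∃ a, A *ᵥ a = v ∧ ∀ j, (a j).natAbs ≤ M := by
  obtain ⟨c₀, hc₀⟩ : ∃ c : m ↪ n, (A.submatrix id c).det ≠ 0 := by
    by_contra! h
    rw [Finset.gcd_eq_zero_iff.mpr fun c _ => h c] at hA
    exact zero_ne_one hA
  obtain ⟨c, -, hmax⟩ := Finset.exists_max_image (Finset.univ : Finset (m ↪ n))
    (fun c => (A.submatrix id c).det.natAbs) ⟨c₀, Finset.mem_univ _⟩
  set B := A.submatrix id c with hBdef
  set V := B.det.natAbs with hVdef
  have hVpos : 0 < V :=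
    (Int.natAbs_pos.mpr hc₀).trans_le (hmax c₀ (Finset.mem_univ _))
  have hcard := card_quotient_range_mulVecLin B (Int.natAbs_pos.mp hVpos)
  have : Finite ((m → ℤ) ⧸ B.mulVecLin.range) :=
    Nat.finite_of_card_ne_zero (by rw [hcard]; exact hVpos.ne')
  obtain ⟨x, hx⟩ := exists_mulVec_eq_of_gcd_minors_eq_one A hA v
  obtain ⟨y, hy, hylt⟩ := exists_nat_combination_sum_lt_card
    (fun k => B.mulVecLin.range.mkQ fun r => A r k) x
  rw [hcard] at hylt
  have hsum : ∀ z : n → ℤ, A *ᵥ z = ∑ k, z k • fun r => A r k := by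
    intro z
    ext r
    simp [mulVec, dotProduct, mul_comm]
  obtain ⟨z, hz⟩ : v - A *ᵥ (fun k => (y k : ℤ)) ∈ B.mulVecLin.range := by
    rw [← Submodule.Quotient.mk_eq_zero, ← Submodule.mkQ_apply, map_sub, sub_eq_zero, ← hx,
      hsum, hsum, map_sum, map_sum]
    simp_rw [map_zsmul, natCast_zsmul]
    exact hy.symm
  let a : n → ℤ := fun k => y k + ∑ i, if c i = k then z i else 0
  have ha : A *ᵥ a = v := by
    have hBz : A *ᵥ (fun k => ∑ i, if c i = k then z i else 0) = B *ᵥ z := by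
      ext r
      simp only [mulVec, dotProduct, Finset.mul_sum]
      rw [Finset.sum_comm]
      simp [hBdef]
    have : a = (fun k => (y k : ℤ)) + fun k => ∑ i, if c i = k then z i else 0 := rfl
    rw [this, mulVec_add, hBz]
    rw [mulVecLin_apply] at hz
    rw [hz]
    abel
  have ha_off : ∀ k, (∀ i, c i ≠ k) → a k = y k := fun k hk => by simp [a, hk]
  have hVM : V ≤ M := hM c
  refine ⟨a, ha, fun k => ?_⟩
  by_cases hk : ∃ i, c i = k
  · obtain ⟨i, rfl⟩ := hk
    have hexp := det_updateCol_submatrix_mulVec A c i a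
    rw [ha, ← Finset.add_sum_erase _ _ (Finset.mem_univ (c i)), Function.update_eq_self] at hexp
    have hterm : ∀ k ∈ Finset.univ.erase (c i),
        |a k * (A.submatrix id (Function.update c i k)).det| ≤ (y k : ℤ) * V := by
      intro k hk
      by_cases hk' : ∃ l, c l = k
      · obtain ⟨l, rfl⟩ := hk'
        have hli : l ≠ i := by rintro rfl; simp at hk
        rw [det_zero_of_column_eq hli (by simp [hli])]
        simp
        positivity
      · push Not at hk'
        rw [ha_off k hk', abs_mul, Nat.abs_cast]
        gcongr
        rw [Int.abs_eq_natAbs]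
        exact_mod_cast natAbs_det_submatrix_le A (fun c => hmax c (Finset.mem_univ _)) _
    have hrest : |∑ k ∈ Finset.univ.erase (c i),
        a k * (A.submatrix id (Function.update c i k)).det| ≤ (V - 1 : ℤ) * V := by
      calc _ ≤ ∑ k ∈ Finset.univ.erase (c i), (y k : ℤ) * V :=
            (Finset.abs_sum_le_sum_abs _ _).trans (Finset.sum_le_sum hterm)
        _ ≤ ∑ k, (y k : ℤ) * V :=
            Finset.sum_le_sum_of_subset_of_nonneg (Finset.subset_univ _) fun _ _ _ => by positivity
        _ ≤ (V - 1 : ℤ) * V := by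
            rw [← Finset.sum_mul]
            gcongr
            have : ((∑ k, y k : ℕ) : ℤ) < V := by exact_mod_cast hylt
            push_cast at this
            omega
    have hv : |((A.submatrix id c).updateCol i v).det| ≤ (M : ℤ) := by
      rw [Int.abs_eq_natAbs]; exact_mod_cast hMv c i
    have hprod : |a (c i)| * V ≤ M + (V - 1 : ℤ) * V := by
      have hVabs : (V : ℤ) = |(A.submatrix id c).det| := (Int.abs_eq_natAbs _).symm
      calc |a (c i)| * V = |a (c i) * (A.submatrix id c).det| := by rw [hVabs, abs_mul]
        _ = |((A.submatrix id c).updateCol i v).det - ∑ k ∈ Finset.univ.erase (c i),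
              a k * (A.submatrix id (Function.update c i k)).det| := by rw [hexp]; simp
        _ ≤ _ := (abs_sub _ _).trans (add_le_add hv hrest)
    zify
    have h1 : (1 : ℤ) ≤ V := by exact_mod_cast hVpos
    have h2 : (V : ℤ) ≤ M := by exact_mod_cast hVM
    nlinarith
  · push Not at hk
    rw [ha_off k hk, Int.natAbs_natCast]
    exact (Finset.single_le_sum (f := y) (fun _ _ => Nat.zero_le _) (Finset.mem_univ k)).trans
      (hylt.le.trans hVM)

end Matrix


/-- Let `n > m ≥ 1` and let `L₁, …, L_m` be integer linear forms in `n`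
variables with coefficient matrix `A ∈ ℤ^{m×n}`.  If the `m×m` minors of `A` are coprime,
then `F(x) = ∏ᵢ Lᵢ(x)` represents all integers; moreover, for each `b`, with
`μ(A,b)` the maximum absolute value of the `m×m` minors of the matrix `A` augmented by
the column `(b,1,…,1)ᵀ`, there is `a ∈ ℤⁿ` with `F(a) = b` and `|a| ≤ μ(A,b)`. -/
theorem stmt_8 (m n : ℕ) (hm : 1 ≤ m) (hmn : m < n)
    (A : Matrix (Fin m) (Fin n) ℤ)
    (hcop : Finset.gcd (Finset.univ : Finset (Fin m ↪ Fin n))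
      (fun c => (A.submatrix id c).det) = 1) :
    ∀ b : ℤ, ∃ a : Fin n → ℤ,
      (∏ i : Fin m, ∑ j : Fin n, A i j * a j) = b ∧
      ∀ i : Fin n,
        (a i).natAbs ≤
          (Finset.univ : Finset (Fin m ↪ Fin (n + 1))).sup
            (fun c =>
              (((Matrix.of fun i (j : Fin (n + 1)) =>
                  if h : (j : ℕ) < n then A i ⟨(j : ℕ), h⟩
                  else if (i : ℕ) = 0 then b else 1 :
                  Matrix (Fin m) (Fin (n + 1)) ℤ).submatrix id c).det).natAbs) := by
  intro b
  set B : Matrix (Fin m) (Fin (n + 1)) ℤ := Matrix.of fun i (j : Fin (n + 1)) =>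
    if h : (j : ℕ) < n then A i ⟨(j : ℕ), h⟩ else if (i : ℕ) = 0 then b else 1 with hB
  have hminor : ∀ f : Fin m → Fin (n + 1), (B.submatrix id f).det.natAbs ≤
      (Finset.univ : Finset (Fin m ↪ Fin (n + 1))).sup
        (fun c => (B.submatrix id c).det.natAbs) :=
    Matrix.natAbs_det_submatrix_le B fun c =>
      Finset.le_sup (f := fun c : Fin m ↪ Fin (n + 1) => (B.submatrix id c).det.natAbs)
        (Finset.mem_univ c)
  obtain ⟨a, ha, hbound⟩ := A.exists_mulVec_eq_natAbs_le hcop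
    (fun i => if (i : ℕ) = 0 then b else 1) _
    (fun c => by
      convert hminor (fun i => (c i).castSucc) using 3
      ext r s
      simp [hB])
    (fun c i => by
      convert hminor (Function.update (fun i => (c i).castSucc) i (Fin.last n)) using 3
      ext r s
      by_cases h : s = i
      · subst h; simp [hB]
      · simp [hB, h])
  refine ⟨a, ?_, hbound⟩
  have hrow : ∀ i : Fin m, ∑ j, A i j * a j = if (i : ℕ) = 0 then b else 1 := congrFun ha
  simp_rw [hrow]
  rw [Finset.prod_eq_single ⟨0, hm⟩]
  · simp
  · intro i _ hi
    exact if_neg fun h => hi (Fin.ext h)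
  · simp
end

section
/- Let F be an integer multilinear (n,d)-form with exactly two monomials, F(x) = f_{I₁} ∏_{i∈I₁} x_i + f_{I₂} ∏_{i∈I₂} x_i, where I₁ ≠ I₂ are d-element subsets of {1,…,n} and gcd(f_{I₁}, f_{I₂}) = 1. Then for every integer b there exists a ∈ ℤⁿ with F(a) = b and |a| ≤ max(1, |b|·|F|), where |F| = max(|f_{I₁}|, |f_{I₂}|). -/
/-- Coprime integers admit Bézout coefficients bounded by the larger of their absolute values. -/
theorem IsCoprime.exists_bezout_abs_le_max {f g : ℤ} (h : IsCoprime f g) :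
    ∃ u v : ℤ, u * f + v * g = 1 ∧ |u| ≤ max |f| |g| ∧ |v| ≤ max |f| |g| := by
  obtain ⟨p, q, hpq⟩ := h
  by_cases hg : g = 0
  · subst hg
    have hf : p * f = 1 := by linarith
    rcases Int.isUnit_iff.mp (IsUnit.of_mul_eq_one_right p hf) with rfl | rfl
    · exact ⟨1, 0, by simp⟩
    · exact ⟨-1, 0, by simp⟩
  · have hg_pos : 0 < |g| := abs_pos.mpr hg
    have hu_nonneg : 0 ≤ p % g := Int.emod_nonneg p hg
    have hu_lt : p % g < |g| := Int.emod_lt_abs p hg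
    have hdiv : p % g + g * (p / g) = p := Int.emod_add_mul_ediv p g
    have hbez : p % g * f + (q + p / g * f) * g = 1 := by
      linear_combination hpq + f * hdiv
    refine ⟨p % g, q + p / g * f, hbez, ?_, ?_⟩
    · rw [abs_of_nonneg hu_nonneg]
      exact hu_lt.le.trans (le_max_right _ _)
    · generalize q + p / g * f = v at hbez ⊢
      refine le_of_mul_le_mul_right ?_ hg_pos
      have hM : 1 ≤ max |f| |g| := le_max_of_le_right hg_pos
      calc |v| * |g| = |1 - p % g * f| := by
            rw [← abs_mul]
            congr 1
            linarith
        _ ≤ 1 + p % g * |f| := by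
            simpa [abs_mul, abs_of_nonneg hu_nonneg] using abs_sub 1 (p % g * f)
        _ ≤ 1 + (|g| - 1) * max |f| |g| := by
            gcongr
            · linarith
            · linarith
            · exact le_max_left _ _
        _ ≤ max |f| |g| * |g| := by linarith

/-- Distinct finite sets of equal cardinality: the first has an element outside the second. -/
theorem Finset.exists_mem_notMem_of_card_eq_of_ne {α : Type*} {s t : Finset α}
    (hcard : s.card = t.card) (hne : s ≠ t) : ∃ x ∈ s, x ∉ t := by
  by_contra! hsub
  exact hne (Finset.eq_of_subset_of_card_le hsub hcard.ge)

/-- Let `F(x) = f₁ ∏_{i ∈ I₁} x_i + f₂ ∏_{i ∈ I₂} x_i` be an integer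
multilinear `(n,d)`-form with exactly two monomials, `I₁ ≠ I₂` of cardinality `d`, and
`gcd(f₁, f₂) = 1`.  Then for every integer `b` there is `a ∈ ℤⁿ` with `F(a) = b` and
`|a| ≤ max (1, |b|·|F|)` where `|F| = max (|f₁|, |f₂|)`. -/
theorem stmt_11 (n d : ℕ) (I₁ I₂ : Finset (Fin n))
    (hI₁ : I₁.card = d) (hI₂ : I₂.card = d) (hne : I₁ ≠ I₂)
    (f₁ f₂ : ℤ) (hcop : IsCoprime f₁ f₂) :
    ∀ b : ℤ, ∃ a : Fin n → ℤ,
      (f₁ * ∏ i ∈ I₁, a i + f₂ * ∏ i ∈ I₂, a i) = b ∧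
      ∀ i : Fin n, |a i| ≤ max 1 (|b| * max |f₁| |f₂|) := by
  intro b
  obtain ⟨k, hk₁, hk₂⟩ := Finset.exists_mem_notMem_of_card_eq_of_ne (hI₁.trans hI₂.symm) hne
  obtain ⟨m, hm₂, hm₁⟩ := Finset.exists_mem_notMem_of_card_eq_of_ne (hI₂.trans hI₁.symm) hne.symm
  obtain ⟨u, v, huv, hu, hv⟩ := hcop.exists_bezout_abs_le_max
  have hmk : m ≠ k := fun h => hm₁ (h ▸ hk₁)
  refine ⟨fun i => if i = k then b * u else if i = m then b * v else 1, ?_, fun i => ?_⟩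
  · rw [Finset.prod_eq_single_of_mem k hk₁, Finset.prod_eq_single_of_mem m hm₂]
    · simp only [if_true, if_neg hmk]
      linear_combination b * huv
    · intro i hi him
      simp [him, ne_of_mem_of_not_mem hi hk₂]
    · intro i hi hik
      simp [hik, ne_of_mem_of_not_mem hi hm₁]
  · dsimp only
    split_ifs
    · rw [abs_mul]
      exact le_max_of_le_right (by gcongr)
    · rw [abs_mul]
      exact le_max_of_le_right (by gcongr)
    · simp
end
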